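/- arXiv:2512.20089 — 5 statements merged into one kernel-verified Lean document; each statement's English description precedes it below -/
import Mathlib

section
/- For integers 2 ≤ a ≤ b and 1 ≤ m ≤ b, let G be a connected finite simple graph of order n ≥ (4b + 2a + ab + (b+8)m + 16)/2 with minimum degree δ(G) ≥ a + m. If the spectral radius satisfies ρ(G) ≥ n − b − 1, then G is a fractional (a,b,m)-covered graph. -/
open Finset

/-- A fractional `[a,b]`-factor of `G`: a function `h` on (potential) edges taking values
in `[0,1]` on edges of `G`, such that for every vertex `u` the total weight of edges of `G`
incident with `u` lies between `a` and `b`. -/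
def SimpleGraph.IsFracFactor {V : Type*} [Fintype V] [DecidableEq V]
    (G : SimpleGraph V) [DecidableRel G.Adj] (a b : ℕ) (h : Sym2 V → ℝ) : Prop :=
  (∀ e ∈ G.edgeSet, 0 ≤ h e ∧ h e ≤ 1) ∧
  ∀ u : V, (a : ℝ) ≤ ∑ e ∈ G.incidenceFinset u, h e ∧
    ∑ e ∈ G.incidenceFinset u, h e ≤ (b : ℝ)

/-- `G` is fractional `(a,b,m)`-covered: for every set `M` of `m` edges of `G` there is a
fractional `[a,b]`-factor `h` of `G` with `h e = 1` for all `e ∈ M`. -/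
def SimpleGraph.IsFracABMCovered {V : Type*} [Fintype V] [DecidableEq V]
    (G : SimpleGraph V) [DecidableRel G.Adj] (a b m : ℕ) : Prop :=
  ∀ M : Finset (Sym2 V), ↑M ⊆ G.edgeSet → M.card = m →
    ∃ h : Sym2 V → ℝ, G.IsFracFactor a b h ∧ ∀ e ∈ M, h e = 1

/-- The spectral radius of a finite simple graph: the largest eigenvalue (as a supremum of
the set of eigenvalues) of its adjacency matrix. -/
noncomputable def SimpleGraph.specRad {V : Type*} [Fintype V] [DecidableEq V]
    (G : SimpleGraph V) : ℝ :=
  letI := Classical.decRel G.Adj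
  sSup {μ : ℝ | Module.End.HasEigenvalue (Matrix.toLin' (G.adjMatrix ℝ)) μ}

/-- The functional on `V → ℝ` whose nonnegativity on vectors with entries in `{-1, 0, 1}`
characterises the existence of a weighting between `lo` and `up` with all degrees in `[a, b]`. -/
noncomputable def degreeSlack {V : Type*} [Fintype V] (a b : ℝ) (lo up : V → V → ℝ)
    (κ : V → ℝ) : ℝ :=
  (∑ v, (b * max (κ v) 0 - a * max (-κ v) 0)) +
    (∑ u, ∑ v, (up u v * max (-(κ u + κ v)) 0 - lo u v * max (κ u + κ v) 0)) / 2

/-- `degreeSlack` is additive along the level sets of `|κ|`, so it is nonnegative as soon as it is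
nonnegative on vectors with entries in `{-1, 0, 1}`. -/
theorem degreeSlack_nonneg {V : Type*} [Fintype V] (a b : ℝ) (lo up : V → V → ℝ)
    (hσ : ∀ σ : V → ℝ, (∀ v, σ v = -1 ∨ σ v = 0 ∨ σ v = 1) → 0 ≤ degreeSlack a b lo up σ)
    (κ : V → ℝ) : 0 ≤ degreeSlack a b lo up κ := by
  classical
  induction hk : #{v | κ v ≠ 0} using Nat.strong_induction_on generalizing κ with
  | _ k ih =>
    rcases ({v | κ v ≠ 0} : Finset V).eq_empty_or_nonempty with h0 | hne
    · have : ∀ v, κ v = 0 := by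
        intro v
        by_contra hv
        have : v ∈ ({v | κ v ≠ 0} : Finset V) := by simpa using hv
        simp [h0] at this
      exact hσ κ fun v => Or.inr (Or.inl (this v))
    · obtain ⟨p, hp, hmin⟩ := exists_min_image _ (fun v => |κ v|) hne
      have hp' : κ p ≠ 0 := by simpa using hp
      have hmin' : ∀ v, κ v ≠ 0 → |κ p| ≤ |κ v| := fun v hv => hmin v (by simpa using hv)
      set θ := |κ p| with hθ
      have hθ0 : 0 < θ := abs_pos.mpr hp'
      let σ : V → ℝ := fun v => if 0 < κ v then 1 else if κ v < 0 then -1 else 0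
      have hcases : ∀ v, (σ v = 1 ∧ θ ≤ κ v) ∨ (σ v = -1 ∧ θ ≤ -κ v) ∨ (σ v = 0 ∧ κ v = 0) := by
        intro v
        rcases lt_trichotomy (κ v) 0 with h | h | h
        · have := hmin' v h.ne
          rw [abs_of_neg h] at this
          exact Or.inr (Or.inl ⟨by simp [σ, h, h.le], this⟩)
        · exact Or.inr (Or.inr ⟨by simp [σ, h], h⟩)
        · have := hmin' v h.ne'
          rw [abs_of_pos h] at this
          exact Or.inl ⟨by simp [σ, h], this⟩
      have hσ1 := hσ σ fun v => by rcases hcases v with h | h | h <;> simp [h.1]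
      have hrest : 0 ≤ degreeSlack a b lo up (fun v => κ v - θ * σ v) := by
        refine ih _ ?_ _ rfl
        rw [← hk]
        refine card_lt_card ⟨?_, ?_⟩
        · intro v hv
          simp only [mem_filter, mem_univ, true_and] at hv ⊢
          rintro h
          rcases hcases v with h' | h' | h'
          · linarith
          · linarith
          · simp [h'] at hv
        · intro hsub
          have := hsub hp
          simp only [mem_filter, mem_univ, true_and] at this
          apply this
          rcases hcases p with h' | h' | h'
          · rw [h'.1, hθ, abs_of_pos (by linarith)]; ring
          · rw [h'.1, hθ, abs_of_neg (by linarith)]; ring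
          · exact absurd h'.2 hp'
      have hadd : degreeSlack a b lo up κ =
          θ * degreeSlack a b lo up σ + degreeSlack a b lo up (fun v => κ v - θ * σ v) := by
        have h1 : ∀ v, max (κ v) 0 = θ * max (σ v) 0 + max (κ v - θ * σ v) 0 := by
          intro v
          rcases hcases v with ⟨h, h'⟩ | ⟨h, h'⟩ | ⟨h, h'⟩ <;> rw [h] <;> grind
        have h2 : ∀ v, max (-κ v) 0 = θ * max (-σ v) 0 + max (-(κ v - θ * σ v)) 0 := by
          intro v
          rcases hcases v with ⟨h, h'⟩ | ⟨h, h'⟩ | ⟨h, h'⟩ <;> rw [h] <;> grind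
        have h3 : ∀ u v, max (κ u + κ v) 0 =
            θ * max (σ u + σ v) 0 + max (κ u - θ * σ u + (κ v - θ * σ v)) 0 := by
          intro u v
          rcases hcases v with ⟨h, h'⟩ | ⟨h, h'⟩ | ⟨h, h'⟩ <;>
          rcases hcases u with ⟨g, g'⟩ | ⟨g, g'⟩ | ⟨g, g'⟩ <;> rw [h, g] <;> grind
        have h4 : ∀ u v, max (-(κ u + κ v)) 0 =
            θ * max (-(σ u + σ v)) 0 + max (-(κ u - θ * σ u + (κ v - θ * σ v))) 0 := by
          intro u v
          rcases hcases v with ⟨h, h'⟩ | ⟨h, h'⟩ | ⟨h, h'⟩ <;>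
          rcases hcases u with ⟨g, g'⟩ | ⟨g, g'⟩ | ⟨g, g'⟩ <;> rw [h, g] <;> grind
        simp only [degreeSlack]
        rw [mul_add, mul_div_assoc', mul_sum, mul_sum, add_add_add_comm, ← sum_add_distrib,
          ← add_div, ← sum_add_distrib]
        congr 1
        · refine sum_congr rfl fun v _ => ?_
          rw [h1, h2]; ring
        · congr 1
          refine sum_congr rfl fun u _ => ?_
          rw [mul_sum, ← sum_add_distrib]
          refine sum_congr rfl fun v _ => ?_
          rw [h3, h4]; ring
      rw [hadd]
      positivity

/-- The existence criterion behind fractional factors, by separating the compact convex set of degree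
vectors from the box `[a, b]`. -/
theorem exists_weights_of_degreeSlack_nonneg {V : Type*} [Fintype V] {a b : ℝ} (hab : a ≤ b)
    {lo up : V → V → ℝ} (hlu : lo ≤ up)
    (hσ : ∀ σ : V → ℝ, (∀ v, σ v = -1 ∨ σ v = 0 ∨ σ v = 1) → 0 ≤ degreeSlack a b lo up σ) :
    ∃ w ∈ Set.Icc lo up, ∀ v, ∑ u, (w v u + w u v) / 2 ∈ Set.Icc a b := by
  classical
  let L : (V → V → ℝ) →ₗ[ℝ] (V → ℝ) :=
    { toFun := fun w v => ∑ u, (w v u + w u v) / 2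
      map_add' := by
        intro x y; ext v; simp only [Pi.add_apply, ← sum_add_distrib]
        exact sum_congr rfl fun u _ => by ring
      map_smul' := by
        intro r x; ext v; simp only [Pi.smul_apply, smul_eq_mul, mul_sum, RingHom.id_apply]
        exact sum_congr rfl fun u _ => by ring }
  have hLc : Continuous L := L.continuous_of_finiteDimensional
  by_contra hcon
  push Not at hcon
  have hdisj : Disjoint (L '' Set.Icc lo up) (Set.Icc (fun _ => a) (fun _ => b)) := by
    rw [Set.disjoint_left]
    rintro _ ⟨w, hw, rfl⟩ hbox
    obtain ⟨v, hv⟩ := hcon w hw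
    exact hv ⟨hbox.1 v, hbox.2 v⟩
  have hcompact : IsCompact (Set.Icc lo up) := by
    have : Set.Icc lo up = Set.pi Set.univ fun u => Set.pi Set.univ fun v =>
        Set.Icc (lo u v) (up u v) := by
      ext w; simp [Pi.le_def]
    rw [this]
    exact isCompact_univ_pi fun u => isCompact_univ_pi fun v => isCompact_Icc
  obtain ⟨f, s, t, hs, hst, ht⟩ := geometric_hahn_banach_compact_closed
    ((convex_Icc lo up).linear_image L) (hcompact.image hLc) (convex_Icc (fun _ : V => a) (fun _ => b))
    isClosed_Icc hdisj
  let c : V → ℝ := fun v => f (Pi.single v 1)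
  have hf : ∀ z : V → ℝ, f z = ∑ v, c v * z v := by
    intro z
    conv_lhs => rw [← Finset.univ_sum_single z]
    rw [map_sum]
    refine sum_congr rfl fun v _ => ?_
    have : (Pi.single v (z v) : V → ℝ) = z v • Pi.single v 1 := by
      rw [← Pi.single_smul]; simp
    rw [this, map_smul, smul_eq_mul, mul_comm]
  let w : V → V → ℝ := fun u v => if 0 ≤ c u + c v then up u v else lo u v
  let y : V → ℝ := fun v => if 0 ≤ c v then a else b
  have hw : w ∈ Set.Icc lo up := by
    constructor <;> intro u v <;> simp only [w] <;> split_ifs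
    exacts [hlu u v, le_rfl, le_rfl, hlu u v]
  have hy : y ∈ Set.Icc (fun _ : V => a) (fun _ => b) := by
    constructor <;> intro v <;> simp only [y] <;> split_ifs <;> linarith
  have h1 : f (L w) < f y := (hs _ ⟨w, hw, rfl⟩).trans (hst.trans (ht _ hy))
  have h2 := degreeSlack_nonneg a b lo up hσ (fun v => -c v)
  rw [hf, hf] at h1
  have h3 : ∑ v, c v * L w v = (∑ u, ∑ v, (c u + c v) * w u v) / 2 := by
    have : ∀ v, c v * L w v = (∑ u, c v * w v u + ∑ u, c v * w u v) / 2 := by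
      intro v
      change c v * ∑ u, (w v u + w u v) / 2 = _
      rw [← sum_add_distrib, mul_sum, sum_div]
      exact sum_congr rfl fun u _ => by ring
    rw [sum_congr rfl fun v _ => this v, ← sum_div, sum_add_distrib]
    congr 1
    rw [sum_comm (f := fun v u => c v * w u v), ← sum_add_distrib]
    refine sum_congr rfl fun u _ => ?_
    rw [← sum_add_distrib]
    exact sum_congr rfl fun v _ => by ring
  have h4 : degreeSlack a b lo up (fun v => -c v) =
      (∑ u, ∑ v, (c u + c v) * w u v) / 2 - ∑ v, c v * y v := by
    simp only [degreeSlack]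
    rw [sub_eq_neg_add, ← sum_neg_distrib]
    congr 1
    · refine sum_congr rfl fun v _ => ?_
      simp only [y]
      split_ifs with h
      · rw [max_eq_right (by linarith), max_eq_left (by linarith)]; ring
      · rw [max_eq_left (by linarith), max_eq_right (by linarith)]; ring
    · congr 1
      refine sum_congr rfl fun u _ => sum_congr rfl fun v _ => ?_
      simp only [w]
      split_ifs with h
      · rw [max_eq_left (by linarith), max_eq_right (by linarith)]; ring
      · rw [max_eq_right (by linarith), max_eq_left (by linarith)]; ring
  linarith


/-- The absolute value of an eigenvector for the spectral radius, normalised to have maximum `1`. -/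
theorem SimpleGraph.exists_subeigenvector {V : Type*} [Fintype V] [DecidableEq V]
    (G : SimpleGraph V) [DecidableRel G.Adj] (hρ : 0 < G.specRad) :
    ∃ y : V → ℝ, (∀ v, 0 ≤ y v) ∧ (∀ v, y v ≤ 1) ∧ (∃ v, y v = 1) ∧
      ∀ v, G.specRad * y v ≤ ∑ u ∈ G.neighborFinset v, y u := by
  have hev : Module.End.HasEigenvalue (Matrix.toLin' (G.adjMatrix ℝ)) G.specRad := by
    have hset : G.specRad =
        sSup {μ : ℝ | Module.End.HasEigenvalue (Matrix.toLin' (G.adjMatrix ℝ)) μ} := by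
      unfold SimpleGraph.specRad
      congr!
    have hne : {μ : ℝ | Module.End.HasEigenvalue (Matrix.toLin' (G.adjMatrix ℝ)) μ}.Nonempty := by
      by_contra h
      rw [Set.not_nonempty_iff_eq_empty] at h
      rw [hset, h, Real.sSup_empty] at hρ
      exact hρ.false
    have := hne.csSup_mem (Module.End.finite_hasEigenvalue _)
    rwa [← hset] at this
  obtain ⟨x, hx⟩ := hev.exists_hasEigenvector
  have hAx : ∀ v, ∑ u ∈ G.neighborFinset v, x u = G.specRad * x v := by
    intro v
    have := congrFun hx.apply_eq_smul v
    simpa [Matrix.toLin'_apply, SimpleGraph.adjMatrix_mulVec_apply] using this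
  obtain ⟨v₀, hv₀⟩ := Function.ne_iff.mp hx.2
  obtain ⟨w, -, hw⟩ := exists_max_image univ (fun v => |x v|) ⟨v₀, mem_univ _⟩
  have hw0 : 0 < |x w| := (abs_pos.mpr hv₀).trans_le (hw v₀ (mem_univ _))
  refine ⟨fun v => |x v| / |x w|, fun v => by positivity,
    fun v => (div_le_one hw0).mpr (hw v (mem_univ _)), ⟨w, div_self hw0.ne'⟩, fun v => ?_⟩
  have hxv : G.specRad * |x v| = |∑ u ∈ G.neighborFinset v, x u| := by
    rw [hAx, abs_mul, abs_of_pos hρ]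
  rw [← sum_div, mul_div_assoc', div_le_div_iff_of_pos_right hw0, hxv]
  exact abs_sum_le_sum_abs _ _


/-- Bounds on the spectral radius in terms of the degrees in a set `T` of vertices, obtained by
comparing `G` with the complete graph on the complement of `T`. -/
theorem SimpleGraph.specRad_mul_le_sum_degree {V : Type*} [Fintype V] [DecidableEq V]
    (G : SimpleGraph V) [DecidableRel G.Adj] (hρ : 0 < G.specRad) (T : Finset V) :
    G.specRad * (G.specRad - (Fintype.card V - #T - 1)) ≤ ∑ v ∈ T, (G.degree v : ℝ) ∧
    (Fintype.card V - #T - 1 ≤ G.specRad →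
      (G.specRad - (Fintype.card V - #T - 1)) *
        (2 * (G.specRad + 1 - (∑ v ∈ T, (G.degree v : ℝ)) / G.specRad) - (Fintype.card V - #T)) ≤
      (∑ v ∈ T, (G.degree v : ℝ) ^ 2) / G.specRad) := by
  obtain ⟨y, hy0, hy1, ⟨w, hw⟩, hy⟩ := G.exists_subeigenvector hρ
  set ρ := G.specRad
  have hcard : (#Tᶜ : ℝ) = Fintype.card V - #T := by
    rw [card_compl, Nat.cast_sub (card_le_univ T)]
  have hdeg : ∀ v, ∀ U : Finset V, ∑ u ∈ U, (if G.Adj v u then y u else 0) ≤ G.degree v := by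
    intro v U
    calc ∑ u ∈ U, (if G.Adj v u then y u else 0)
        ≤ ∑ u, (if G.Adj v u then y u else 0) := by
          refine sum_le_sum_of_subset_of_nonneg (subset_univ _) fun u _ _ => ?_
          split_ifs
          exacts [hy0 u, le_rfl]
      _ ≤ ∑ u, (if G.Adj v u then 1 else 0) := by
          refine sum_le_sum fun u _ => ?_
          split_ifs
          exacts [hy1 u, le_rfl]
      _ = G.degree v := by
          rw [sum_boole, ← G.neighborFinset_eq_filter, G.card_neighborFinset_eq_degree]
  have hnbr : ∀ v, ∑ u ∈ G.neighborFinset v, y u = ∑ u, (if G.Adj v u then y u else 0) := by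
    intro v
    rw [← sum_filter, ← G.neighborFinset_eq_filter]
  have hT : ∑ v ∈ T, y v ≤ (∑ v ∈ T, (G.degree v : ℝ)) / ρ := by
    rw [le_div_iff₀ hρ, sum_mul]
    refine sum_le_sum fun v _ => ?_
    rw [mul_comm]
    exact ((hy v).trans_eq (hnbr v)).trans (hdeg v univ)
  have hw' : ρ + 1 ≤ ∑ v ∈ Tᶜ, y v + ∑ v ∈ T, y v := by
    rw [sum_compl_add_sum]
    have h1 := hy w
    have h2 : ∑ u ∈ G.neighborFinset w, y u ≤ ∑ u ∈ univ.erase w, y u :=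
      sum_le_sum_of_subset_of_nonneg
        (fun u hu => mem_erase.mpr ⟨by rintro rfl; simp at hu, mem_univ _⟩) fun u _ _ => hy0 u
    have h3 := sum_erase_add univ y (mem_univ w)
    rw [hw] at h1 h3
    linarith
  constructor
  · have h1 : ∑ v ∈ Tᶜ, y v ≤ Fintype.card V - #T := by
      rw [← hcard]
      simpa using sum_le_card_nsmul Tᶜ y 1 fun v _ => hy1 v
    rw [mul_comm, ← le_div_iff₀ hρ]
    linarith
  · intro hc
    have hsq : 2 * (ρ + 1 - (∑ v ∈ T, (G.degree v : ℝ)) / ρ) - (Fintype.card V - #T) ≤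
        ∑ v ∈ Tᶜ, y v ^ 2 := by
      have : ∑ v ∈ Tᶜ, (2 * y v - 1) ≤ ∑ v ∈ Tᶜ, y v ^ 2 :=
        sum_le_sum fun v _ => by nlinarith [sq_nonneg (y v - 1)]
      rw [sum_sub_distrib, ← mul_sum, sum_const, nsmul_eq_mul, mul_one, hcard] at this
      linarith
    refine (mul_le_mul_of_nonneg_left hsq (by linarith)).trans ?_
    have hQ : ρ * (∑ v ∈ Tᶜ, y v ^ 2 + ∑ v ∈ T, y v ^ 2) ≤
        ∑ v ∈ Tᶜ, y v * ∑ u, (if G.Adj v u then y u else 0) +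
          ∑ v ∈ T, y v * ∑ u, (if G.Adj v u then y u else 0) := by
      rw [sum_compl_add_sum, sum_compl_add_sum, mul_sum]
      refine sum_le_sum fun v _ => ?_
      have := mul_le_mul_of_nonneg_left ((hy v).trans_eq (hnbr v)) (hy0 v)
      linarith
    have hTT : ∑ v ∈ T, y v * ∑ u, (if G.Adj v u then y u else 0) ≤
        ∑ v ∈ T, y v * G.degree v :=
      sum_le_sum fun v _ => mul_le_mul_of_nonneg_left (hdeg v univ) (hy0 v)
    have hRT : ∑ v ∈ Tᶜ, y v * ∑ u ∈ T, (if G.Adj v u then y u else 0) ≤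
        ∑ v ∈ T, y v * G.degree v := by
      simp only [mul_sum]
      rw [sum_comm]
      refine sum_le_sum fun u _ => ?_
      calc ∑ v ∈ Tᶜ, y v * (if G.Adj v u then y u else 0)
          = y u * ∑ v ∈ Tᶜ, (if G.Adj u v then y v else 0) := by
            rw [mul_sum]
            refine sum_congr rfl fun v _ => ?_
            simp only [G.adj_comm v u]
            split_ifs <;> ring
        _ ≤ _ := mul_le_mul_of_nonneg_left (hdeg u _) (hy0 u)
    have hRR : ∑ v ∈ Tᶜ, y v * ∑ u ∈ Tᶜ, (if G.Adj v u then y u else 0) ≤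
        (Fintype.card V - #T - 1) * ∑ v ∈ Tᶜ, y v ^ 2 := by
      calc _ ≤ ∑ v ∈ Tᶜ, y v * (∑ u ∈ Tᶜ, y u - y v) := by
            refine sum_le_sum fun v hv => mul_le_mul_of_nonneg_left ?_ (hy0 v)
            rw [← sum_erase_add _ _ hv, ← sum_erase_add _ y hv]
            simp only [SimpleGraph.irrefl, if_false, add_zero, add_sub_cancel_right]
            refine sum_le_sum fun u _ => ?_
            split_ifs
            exacts [le_rfl, hy0 u]
        _ = (∑ v ∈ Tᶜ, y v) ^ 2 - ∑ v ∈ Tᶜ, y v ^ 2 := by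
            rw [sq, sum_mul, ← sum_sub_distrib]
            exact sum_congr rfl fun v _ => by ring
        _ ≤ _ := by
            have := sq_sum_le_card_mul_sum_sq (s := Tᶜ) (f := y)
            rw [hcard] at this
            linarith
    have hsplit : ∑ v ∈ Tᶜ, y v * ∑ u, (if G.Adj v u then y u else 0) =
        ∑ v ∈ Tᶜ, y v * ∑ u ∈ Tᶜ, (if G.Adj v u then y u else 0) +
        ∑ v ∈ Tᶜ, y v * ∑ u ∈ T, (if G.Adj v u then y u else 0) := by
      rw [← sum_add_distrib]
      refine sum_congr rfl fun v _ => ?_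
      rw [← mul_add, sum_compl_add_sum]
    have hopt : 2 * ∑ v ∈ T, y v * G.degree v - ρ * ∑ v ∈ T, y v ^ 2 ≤
        (∑ v ∈ T, (G.degree v : ℝ) ^ 2) / ρ := by
      rw [mul_sum, mul_sum, ← sum_sub_distrib, sum_div]
      refine sum_le_sum fun v _ => ?_
      rw [le_div_iff₀ hρ]
      nlinarith [sq_nonneg (ρ * y v - G.degree v)]
    linarith

/-- A cut condition on disjoint vertex sets that suffices for being fractional `(a,b,m)`-covered. -/
theorem SimpleGraph.isFracABMCovered_of_forall_disjoint {V : Type*} [Fintype V] [DecidableEq V]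
    (G : SimpleGraph V) [DecidableRel G.Adj] {a b m : ℕ} (hab : a ≤ b)
    (h : ∀ S T : Finset V, Disjoint S T →
      a * #T + min 2 #S * m ≤ b * #S + ∑ v ∈ T, #(G.neighborFinset v \ S)) :
    G.IsFracABMCovered a b m := by
  intro M hM hMm
  let lo : V → V → ℝ := fun u v => if s(u, v) ∈ M then 1 else 0
  let up : V → V → ℝ := fun u v => if G.Adj u v then 1 else 0
  have hMG : ∀ u v, s(u, v) ∈ M → G.Adj u v := fun u v huv => hM huv
  have hlo : lo ≤ up := by
    intro u v
    simp only [lo, up]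
    split_ifs with h1 h2
    exacts [le_rfl, absurd (hMG u v h1) h2, zero_le_one, le_rfl]
  have hlosum : ∑ u, ∑ v, lo u v ≤ 2 * m := by
    simp only [lo]
    rw [← sum_product', sum_boole]
    have hfib := card_le_mul_card_image_of_maps_to
      (s := {x ∈ (univ : Finset V) ×ˢ (univ : Finset V) | s(x.1, x.2) ∈ M}) (t := M)
      (f := fun x : V × V => s(x.1, x.2)) (fun x hx => (mem_filter.mp hx).2) 2 (by
        intro e _
        induction e using Sym2.ind with
        | _ p q =>
          refine (card_le_card (t := {(p, q), (q, p)}) ?_).trans card_le_two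
          rintro ⟨u, v⟩ hx
          have := (mem_filter.mp hx).2
          simpa [Sym2.eq_iff] using this)
    rw [hMm] at hfib
    exact_mod_cast hfib
  obtain ⟨w, ⟨hw1, hw2⟩, hw3⟩ := exists_weights_of_degreeSlack_nonneg
    (a := (a : ℝ)) (b := b) (by exact_mod_cast hab) hlo (by
    intro σ hσ
    let S : Finset V := {v | σ v = 1}
    let T : Finset V := {v | σ v = -1}
    have hST : Disjoint S T := by
      rw [Finset.disjoint_left]
      intro v h1 h2
      have h1' : σ v = 1 := by simpa [S] using h1
      have h2' : σ v = -1 := by simpa [T] using h2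
      linarith
    have hineq : (a * #T + min 2 #S * m : ℝ) ≤
        b * #S + ∑ v ∈ T, (#(G.neighborFinset v \ S) : ℝ) := by
      exact_mod_cast h S T hST
    have hvert : ∑ v, ((b : ℝ) * max (σ v) 0 - a * max (-σ v) 0) = b * #S - a * #T := by
      rw [sum_sub_distrib, ← mul_sum, ← mul_sum]
      simp only [S, T, card_filter, Nat.cast_sum]
      congr 2 <;> refine sum_congr rfl fun v _ => ?_ <;>
        rcases hσ v with hv | hv | hv <;> rw [hv] <;> norm_num
    have hup : ∑ u, ∑ v, up u v * max (-(σ u + σ v)) 0 =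
        2 * ∑ v ∈ T, (#(G.neighborFinset v \ S) : ℝ) := by
      have hD : ∑ v ∈ T, (#(G.neighborFinset v \ S) : ℝ) =
          ∑ u, ∑ v, up u v * (if σ u = -1 ∧ σ v ≠ 1 then 1 else 0) := by
        simp only [T]
        rw [sum_filter]
        refine sum_congr rfl fun u _ => ?_
        split_ifs with hu
        · have : G.neighborFinset u \ S = ({v | G.Adj u v ∧ σ v ≠ 1} : Finset V) := by
            ext v; simp [S]
          rw [this, card_filter, Nat.cast_sum]
          refine sum_congr rfl fun v _ => ?_
          simp only [up, hu]
          split_ifs <;> simp_all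
        · simp [hu]
      have hD' : ∑ v ∈ T, (#(G.neighborFinset v \ S) : ℝ) =
          ∑ u, ∑ v, up u v * (if σ v = -1 ∧ σ u ≠ 1 then 1 else 0) := by
        rw [hD, sum_comm]
        simp only [up, G.adj_comm]
      rw [two_mul]
      nth_rw 1 [hD]
      rw [hD', ← sum_add_distrib]
      refine sum_congr rfl fun u _ => ?_
      rw [← sum_add_distrib]
      refine sum_congr rfl fun v _ => ?_
      rw [← mul_add]
      congr 1
      rcases hσ v with hv | hv | hv <;> rcases hσ u with hu | hu | hu <;> rw [hv, hu] <;> norm_num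
    have hlow : ∑ u, ∑ v, lo u v * max (σ u + σ v) 0 ≤ 2 * (min 2 #S * m) := by
      calc ∑ u, ∑ v, lo u v * max (σ u + σ v) 0 ≤ ∑ u, ∑ v, lo u v * min 2 #S := by
            refine sum_le_sum fun u _ => sum_le_sum fun v _ => ?_
            simp only [lo]
            split_ifs with huv
            · have hne : u ≠ v := (hMG u v huv).ne
              have hle : ∀ x, σ x = 1 → (1 : ℝ) ≤ #S := by
                intro x hx
                have : 1 ≤ #S := card_pos.mpr ⟨x, by simpa [S] using hx⟩
                exact_mod_cast this
              have hle2 : σ u = 1 → σ v = 1 → (2 : ℝ) ≤ #S := by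
                intro hu hv
                have : 1 < #S := one_lt_card.mpr
                  ⟨u, by simpa [S] using hu, v, by simpa [S] using hv, hne⟩
                exact_mod_cast this
              have h0 : (0 : ℝ) ≤ #S := Nat.cast_nonneg _
              rw [one_mul, one_mul, Nat.cast_min, Nat.cast_ofNat, le_min_iff]
              refine ⟨max_le ?_ zero_le_two, max_le ?_ h0⟩ <;>
                rcases hσ u with hu | hu | hu <;> rcases hσ v with hv | hv | hv <;>
                first
                | linarith
                | linarith [hle u hu]
                | linarith [hle v hv]
                | linarith [hle2 hu hv]
            · simp
        _ = (∑ u, ∑ v, lo u v) * min 2 #S := by simp only [sum_mul]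
        _ ≤ 2 * m * min 2 #S := mul_le_mul_of_nonneg_right hlosum (by positivity)
        _ = _ := by ring
    rw [degreeSlack, hvert]
    simp only [sum_sub_distrib]
    rw [hup]
    linarith)
  refine ⟨Sym2.lift ⟨fun u v => (w u v + w v u) / 2, fun u v => by ring⟩, ⟨?_, ?_⟩, ?_⟩
  · intro e he
    induction e using Sym2.ind with
    | _ u v =>
      have huv : G.Adj u v := he
      have h1 := hw1 u v
      have h2 := hw1 v u
      have h3 := hw2 u v
      have h4 := hw2 v u
      simp only [lo] at h1 h2
      simp only [up, huv, huv.symm, if_true] at h3 h4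
      rw [Sym2.lift_mk]
      constructor
      · split_ifs at h1 h2 <;> linarith
      · simp only; linarith
  · intro v
    have hzero : ∀ u, ¬ G.Adj v u → (w v u + w u v) / 2 = 0 := by
      intro u hu
      have hM' : s(v, u) ∉ M := fun hm => hu (hMG _ _ hm)
      have hM'' : s(u, v) ∉ M := by rwa [Sym2.eq_swap]
      have h1 := hw1 u v
      have h2 := hw1 v u
      have h3 := hw2 u v
      have h4 := hw2 v u
      simp only [lo, hM', hM'', if_false] at h1 h2
      simp only [up, hu, G.adj_comm u v, if_false] at h3 h4
      linarith
    have hsum : ∑ e ∈ G.incidenceFinset v,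
        Sym2.lift ⟨fun u v => (w u v + w v u) / 2, fun u v => by ring⟩ e =
          ∑ u, (w v u + w u v) / 2 := by
      have himg : G.incidenceFinset v = (G.neighborFinset v).image fun u => s(v, u) := by
        ext e
        induction e using Sym2.ind with
        | _ p q =>
          simp only [SimpleGraph.mem_incidenceFinset, SimpleGraph.mk'_mem_incidenceSet_iff,
            mem_image, SimpleGraph.mem_neighborFinset, Sym2.eq_iff]
          constructor
          · rintro ⟨hpq, rfl | rfl⟩
            exacts [⟨q, hpq, by simp⟩, ⟨p, hpq.symm, by simp⟩]
          · rintro ⟨u, hu, ⟨rfl, rfl⟩ | ⟨rfl, rfl⟩⟩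
            exacts [⟨hu, Or.inl rfl⟩, ⟨hu.symm, Or.inr rfl⟩]
      rw [himg, sum_image (fun x _ y _ hxy => Sym2.congr_right.mp hxy)]
      simp only [Sym2.lift_mk]
      refine sum_subset (subset_univ _) fun u _ hu => hzero u (by simpa using hu)
    rw [hsum]
    exact hw3 v
  · intro e he
    induction e using Sym2.ind with
    | _ u v =>
      have huv : G.Adj u v := hMG u v he
      have he' : s(v, u) ∈ M := by rwa [Sym2.eq_swap]
      have h1 := hw1 u v
      have h2 := hw1 v u
      have h3 := hw2 u v
      have h4 := hw2 v u
      simp only [lo, he, he', if_true] at h1 h2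
      simp only [up, huv, huv.symm, if_true] at h3 h4
      rw [Sym2.lift_mk]
      simp only
      linarith

/-- A deficient pair `(S, T)` in a graph of minimum degree at least `a + m` has `#T > b`. -/
theorem lt_of_deficient {a b m s t D : ℕ} (hb : 2 ≤ b) (hmb : m ≤ b)
    (hdef : b * s + D + 1 ≤ a * t + min 2 s * m) (hdeg : t * (a + m) ≤ t * s + D) : b < t := by
  by_contra! htb
  rcases Nat.lt_or_ge s 2 with hs | hs
  · interval_cases s
    · simp at hdef
      nlinarith
    · simp only [Nat.reduceLeDiff, inf_of_le_right, mul_one, one_mul] at hdef hdeg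
      rcases Nat.eq_zero_or_pos m with rfl | hm
      · nlinarith
      · rcases Nat.eq_zero_or_pos t with rfl | ht
        · omega
        · obtain ⟨t, rfl⟩ := Nat.exists_eq_add_of_le' ht
          nlinarith [Nat.mul_le_mul_left t hm]
  · rw [min_eq_left hs] at hdef
    rcases Nat.lt_or_ge t 2 with ht | ht
    · interval_cases t <;> nlinarith
    · nlinarith

theorem false_of_deficient_of_two_le {a b m s k n : ℤ} (ha : 2 ≤ a) (hab : a ≤ b) (hm1 : 1 ≤ m)
    (hmb : m ≤ b) (hk : 2 ≤ k) (hn : 4 * b + 2 * a + a * b + (b + 8) * m + 16 ≤ 2 * n)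
    (hs : b * s + 1 ≤ a * (b + k) + 2 * m) (hsn : s + (b + k) ≤ n)
    (hmain : k * (n - b - 1 - s) + 1 ≤ a * (b + k) + 2 * m) : False := by
  have hsk : s ≤ a + k + 1 := by
    by_contra! h
    nlinarith
  have hbm : 2 * m ≤ b * m := by nlinarith
  have hab' : 2 * a ≤ a * b := by nlinarith
  obtain ⟨N, hN⟩ : ∃ N, N = n - b - 1 - s - a := ⟨_, rfl⟩
  obtain ⟨P, hP⟩ : ∃ P, P = a * b + 2 * m - 1 := ⟨_, rfl⟩
  have h1 : k * N ≤ P := by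
    rw [hN, hP]; linarith
  have h2 : P + 21 - 2 * k ≤ 2 * N := by
    rw [hN, hP]; linarith
  have h3 : P < 2 * k := by
    by_contra! h
    nlinarith [mul_nonneg (sub_nonneg.mpr hk) (sub_nonneg.mpr h)]
  have h4 : N ≤ 1 := by
    by_contra! h
    nlinarith
  linarith

theorem false_of_deficient_of_spectral {a b m s D n : ℤ} {ρ X : ℝ} (ha : 2 ≤ a) (hab : a ≤ b)
    (hm1 : 1 ≤ m) (hmb : m ≤ b) (hs : 0 ≤ s) (hD : 0 ≤ D)
    (hn : 4 * b + 2 * a + a * b + (b + 8) * m + 16 ≤ 2 * n)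
    (hdef : b * s + D + 1 ≤ a * (b + 1) + 2 * m) (hdeg : (b + 1) * (a + m) ≤ (b + 1) * s + D)
    (hρ : (n : ℝ) - b - 1 ≤ ρ) (hX : X ≤ (b + 1) * s + D)
    (hmain : (ρ - (n - (b + 1) - 1)) * (2 * (ρ + 1 - X / ρ) - (n - (b + 1))) ≤
      (s + D) * X / ρ) : False := by
  have hs1 : (b - 1) * m + 1 ≤ s := by nlinarith
  have hsD : s + D ≤ 2 * a + 2 := by
    have h1 : s + D ≤ a * (b + 1) - (b - 1) * ((b - 1) * m + 1) + 2 * m - 1 := by nlinarith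
    rcases (show b = 2 ∨ 3 ≤ b by omega) with rfl | hb
    · obtain rfl : a = 2 := by omega
      omega
    · nlinarith [mul_nonneg (sub_nonneg.mpr hb) (sub_nonneg.mpr hm1),
        mul_nonneg (mul_nonneg (sub_nonneg.mpr hb) (sub_nonneg.mpr hb)) (sub_nonneg.mpr hm1),
        mul_nonneg (sub_nonneg.mpr hb) (sub_nonneg.mpr hab)]
  have hXle : (b + 1) * s + D ≤ a * b + 3 * a + 2 * m + 1 := by nlinarith
  have hXn : (b + 1) * s + D ≤ 2 * (n - b - 1) := by nlinarith
  have hna : 4 * a + 7 ≤ n - b - 1 := by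
    nlinarith [sq_nonneg (2 * a - 3), mul_le_mul_of_nonneg_left hab (by omega : 0 ≤ a)]
  have hXnR : ((b + 1) * s + D : ℝ) ≤ 2 * (n - b - 1) := by exact_mod_cast hXn
  have hnaR : (4 * a + 7 : ℝ) ≤ n - b - 1 := by exact_mod_cast hna
  have hsDR : (s + D : ℝ) ≤ 2 * a + 2 := by exact_mod_cast hsD
  have haR : (2 : ℝ) ≤ a := by exact_mod_cast ha
  have hsD0 : (0 : ℝ) ≤ s + D := by exact_mod_cast (by omega : 0 ≤ s + D)
  have hρ0 : 0 < ρ := by linarith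
  have hXρ : X / ρ ≤ 2 := by
    rw [div_le_iff₀ hρ0]; linarith
  have hr : (s + D) * X / ρ ≤ 4 * a + 4 := by
    rw [mul_div_assoc]
    nlinarith [mul_le_mul_of_nonneg_left hXρ hsD0]
  have hY : ρ - 2 ≤ 2 * (ρ + 1 - X / ρ) - (n - (b + 1)) := by linarith
  nlinarith

/-- spectral radius condition for a connected graph of large order and minimum
degree at least `a + m` to be fractional `(a,b,m)`-covered. -/
theorem specRad_ge_implies_fracABMCovered
    {V : Type*} [Fintype V] [DecidableEq V] (G : SimpleGraph V) [DecidableRel G.Adj]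
    (a b m : ℕ) (ha : 2 ≤ a) (hab : a ≤ b) (hm1 : 1 ≤ m) (hmb : m ≤ b)
    (hconn : G.Connected)
    (hn : ((4 * b + 2 * a + a * b + (b + 8) * m + 16 : ℕ) : ℝ) / 2 ≤ (Fintype.card V : ℝ))
    (hδ : ∀ v : V, a + m ≤ G.degree v)
    (hρ : (Fintype.card V : ℝ) - (b : ℝ) - 1 ≤ G.specRad) :
    G.IsFracABMCovered a b m := by
  refine G.isFracABMCovered_of_forall_disjoint hab fun S T hST => ?_
  by_contra! hdef
  have hdv : ∀ v, G.degree v ≤ #S + #(G.neighborFinset v \ S) := by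
    intro v
    rw [← G.card_neighborFinset_eq_degree]
    have := card_le_card_sdiff_add_card (s := G.neighborFinset v) (t := S)
    omega
  have hDv : ∀ v ∈ T, #(G.neighborFinset v \ S) ≤ ∑ v ∈ T, #(G.neighborFinset v \ S) :=
    fun v hv => single_le_sum (f := fun v => #(G.neighborFinset v \ S))
      (fun _ _ => Nat.zero_le _) hv
  have hsum : ∑ v ∈ T, G.degree v ≤ #T * #S + ∑ v ∈ T, #(G.neighborFinset v \ S) := by
    refine (sum_le_sum fun v _ => hdv v).trans_eq ?_
    rw [sum_add_distrib, sum_const, smul_eq_mul]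
  have hlow : #T * (a + m) ≤ ∑ v ∈ T, G.degree v := card_nsmul_le_sum T _ _ fun v _ => hδ v
  have hspec := G.specRad_mul_le_sum_degree (T := T)
  have hst : #S + #T ≤ Fintype.card V := by
    rw [← card_union_of_disjoint hST]
    exact card_le_univ _
  generalize ∑ v ∈ T, #(G.neighborFinset v \ S) = D at hdef hDv hsum
  generalize Fintype.card V = n at *
  generalize #S = s at *
  generalize #T = t at *
  have hn' : 4 * b + 2 * a + a * b + (b + 8) * m + 16 ≤ 2 * n := by
    rw [div_le_iff₀ two_pos] at hn
    have : 4 * b + 2 * a + a * b + (b + 8) * m + 16 ≤ n * 2 := by exact_mod_cast hn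
    omega
  have hdeg : t * (a + m) ≤ t * s + D := hlow.trans hsum
  have hbt : b < t := lt_of_deficient (ha.trans hab) hmb hdef hdeg
  obtain ⟨k, hk⟩ := Nat.exists_eq_add_of_lt hbt
  have hbn : b + 1 < n := by nlinarith
  have hbn' : (b : ℝ) + 1 < n := by exact_mod_cast hbn
  have hρ0 : 0 < G.specRad := by linarith
  obtain ⟨h1, h2⟩ := hspec hρ0
  have hsumR : ∑ v ∈ T, (G.degree v : ℝ) ≤ t * s + D := by exact_mod_cast hsum
  have htR : (t : ℝ) = b + k + 1 := by exact_mod_cast hk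
  have hmin : min 2 s * m ≤ 2 * m := Nat.mul_le_mul_right _ (min_le_left _ _)
  have hdef' : (b * s + D + 1 : ℤ) ≤ a * (b + (k + 1)) + 2 * m := by
    have : b * s + D + 1 ≤ a * (b + (k + 1)) + 2 * m := by
      rw [← add_assoc, ← hk]; omega
    exact_mod_cast this
  rcases Nat.eq_zero_or_pos k with rfl | hk0
  · have hsq : ∑ v ∈ T, (G.degree v : ℝ) ^ 2 ≤ (s + D) * ∑ v ∈ T, (G.degree v : ℝ) := by
      rw [mul_sum]
      refine sum_le_sum fun v hv => ?_
      have hv' : G.degree v ≤ s + D :=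
        (hdv v).trans (Nat.add_le_add_left (hDv v hv) _)
      rw [sq]
      exact mul_le_mul_of_nonneg_right (by exact_mod_cast hv') (Nat.cast_nonneg _)
    have htb : (t : ℝ) = b + 1 := by rw [htR]; simp
    have h3 := (h2 (by rw [htb]; linarith)).trans (div_le_div_of_nonneg_right hsq hρ0.le)
    rw [htb] at h3
    rw [hk] at hdeg
    refine false_of_deficient_of_spectral (a := a) (b := b) (m := m) (s := s) (D := D) (n := n)
      (by exact_mod_cast ha) (by exact_mod_cast hab) (by exact_mod_cast hm1)
      (by exact_mod_cast hmb) (by positivity) (by positivity) (by exact_mod_cast hn')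
      (by simpa using hdef') (by exact_mod_cast hdeg) (by exact_mod_cast hρ)
      (X := ∑ v ∈ T, (G.degree v : ℝ)) ?_ (by exact_mod_cast h3)
    rw [htR] at hsumR
    simpa using hsumR
  · have hmainR : ((k + 1) * (n - b - 1 - s) + 1 : ℝ) ≤ a * (b + (k + 1)) + 2 * m := by
      have h3 : ((n : ℝ) - b - 1) * (k + 1) ≤ t * s + D := by
        refine le_trans ?_ (h1.trans hsumR)
        rw [htR]
        exact mul_le_mul hρ (by linarith) (by positivity) hρ0.le
      have h4 : (b * s + D + 1 : ℝ) ≤ a * (b + (k + 1)) + 2 * m := by exact_mod_cast hdef'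
      rw [htR] at h3
      linarith
    refine false_of_deficient_of_two_le (a := a) (b := b) (m := m) (s := s) (k := k + 1) (n := n)
      (by exact_mod_cast ha) (by exact_mod_cast hab) (by exact_mod_cast hm1)
      (by exact_mod_cast hmb) (by omega) (by exact_mod_cast hn') (by linarith) (by omega) ?_
    exact_mod_cast hmainR
end

section
/- For integers 2 ≤ a ≤ b and 1 ≤ m ≤ b, let G be a connected finite simple graph of order n ≥ 4a + 5b/2 + 4m + 7 with minimum degree δ(G) ≥ a + m. If the number of edges satisfies e(G) ≥ C(n−b−1, 2) + ab + 2a + (b+1)m, where C(·,2) denotes the binomial coefficient, then G is a fractional (a,b,m)-covered graph. -/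
open Finset

/-- Convexity form of the first-order optimality condition for minimizing a sum of squares along
a segment. -/
lemma sum_mul_sub_nonneg_of_forall_sum_sq_le {ι : Type*} [Fintype ι] (y z : ι → ℝ)
    (hmin : ∀ t : ℝ, 0 ≤ t → t ≤ 1 → ∑ i, y i ^ 2 ≤ ∑ i, (y i + t * (z i - y i)) ^ 2) :
    0 ≤ ∑ i, y i * (z i - y i) := by
  by_contra! hneg
  set A := ∑ i, y i * (z i - y i) with hA
  set B := ∑ i, (z i - y i) ^ 2 with hB
  have hB0 : 0 ≤ B := sum_nonneg fun i _ => sq_nonneg _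
  have key : ∀ t : ℝ, 0 ≤ t → t ≤ 1 → 0 ≤ t * (2 * A + t * B) := by
    intro t h0 h1
    have h := hmin t h0 h1
    have e : ∑ i, (y i + t * (z i - y i)) ^ 2 = ∑ i, y i ^ 2 + t * (2 * A + t * B) := by
      rw [hA, hB]
      simp only [mul_sum, mul_add, ← sum_add_distrib]
      exact sum_congr rfl fun i _ => by ring
    linarith
  have hpos : 0 < B - A := by linarith
  have ht1 : -A / (B - A) ≤ 1 := by rw [div_le_one hpos]; linarith
  have ht0 : 0 < -A / (B - A) := div_pos (by linarith) hpos
  have h := nonneg_of_mul_nonneg_right (key _ ht0.le ht1) ht0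
  have htB : -A / (B - A) * B ≤ -A := by
    rw [div_mul_eq_mul_div, div_le_iff₀ hpos]
    nlinarith [sq_nonneg A]
  linarith

/-- A cut criterion for the existence of a symmetric matrix with prescribed entrywise bounds and
prescribed bounds on its row sums. -/
theorem exists_symm_matrix_of_cut {V : Type*} [Fintype V] [DecidableEq V]
    (l c : V → V → ℝ) (g f : V → ℝ) (hlc : l ≤ c) (hgf : g ≤ f)
    (hl : ∀ u v, l u v = l v u) (hc : ∀ u v, c u v = c v u)
    (hcut : ∀ S T : Finset V, Disjoint S T →
      ∑ v ∈ T, g v + ∑ s ∈ S, ∑ v ∈ Tᶜ, l s v ≤ ∑ s ∈ S, f s + ∑ t ∈ T, ∑ v ∈ Sᶜ, c t v) :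
    ∃ w : V → V → ℝ, (∀ u v, w u v = w v u) ∧ l ≤ w ∧ w ≤ c ∧
      ∀ u, g u ≤ ∑ v, w u v ∧ ∑ v, w u v ≤ f u := by
  obtain ⟨⟨w, p⟩, ⟨hw, hp⟩, hmin⟩ :=
    ((isCompact_Icc (a := l) (b := c)).prod (isCompact_Icc (a := g) (b := f))).exists_isMinOn
      (f := fun z : (V → V → ℝ) × (V → ℝ) =>
        ∑ u, (∑ v, (z.1 u v + z.1 v u) / 2 - z.2 u) ^ 2)
      ⟨(l, g), ⟨le_rfl, hlc⟩, ⟨le_rfl, hgf⟩⟩ (by fun_prop)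
  set y : V → ℝ := fun u => ∑ v, (w u v + w v u) / 2 - p u with hy
  have hvar : ∀ w' ∈ Set.Icc l c, ∀ p' ∈ Set.Icc g f,
      0 ≤ ∑ u, y u * ((∑ v, (w' u v + w' v u) / 2 - p' u) - y u) := by
    intro w' hw' p' hp'
    apply sum_mul_sub_nonneg_of_forall_sum_sq_le
    intro t h0 h1
    have hw'' := (convex_Icc l c) hw hw' (sub_nonneg.2 h1) h0 (by ring)
    have hp'' := (convex_Icc g f) hp hp' (sub_nonneg.2 h1) h0 (by ring)
    refine (hmin (Set.mk_mem_prod hw'' hp'')).trans_eq (sum_congr rfl fun u _ => ?_)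
    congr 1
    have e : ∑ v, (((1 - t) • w + t • w') u v + ((1 - t) • w + t • w') v u) / 2
        = (1 - t) * ∑ v, (w u v + w v u) / 2 + t * ∑ v, (w' u v + w' v u) / 2 := by
      simp only [mul_sum, ← sum_add_distrib, Pi.add_apply, Pi.smul_apply, smul_eq_mul]
      exact sum_congr rfl fun v _ => by ring
    dsimp only
    rw [e]
    simp only [hy, Pi.add_apply, Pi.smul_apply, smul_eq_mul]
    ring
  have hpvar : ∀ u x, g u ≤ x → x ≤ f u → 0 ≤ y u * (p u - x) := by
    intro u x hgx hxf
    have h := hvar w hw (Function.update p u x) ⟨fun v => ?_, fun v => ?_⟩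
    · rw [sum_eq_single u] at h
      · simpa [hy] using h
      · intro v _ hv
        simp [hy, Function.update_of_ne hv]
      · simp
    · by_cases hv : v = u
      · subst hv; simpa using hgx
      · simpa [Function.update_of_ne hv] using hp.1 v
    · by_cases hv : v = u
      · subst hv; simpa using hxf
      · simpa [Function.update_of_ne hv] using hp.2 v
  have hwvar : ∀ u v x, l u v ≤ x → x ≤ c u v → 0 ≤ (y u + y v) * (x - w u v) := by
    intro u v x hlx hxc
    have h := hvar (fun i j => w i j + if i = u then (if j = v then x - w u v else 0) else 0)
      ⟨fun i j => ?_, fun i j => ?_⟩ p hp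
    · have e : ∀ i, y i * ((∑ j, ((w i j + if i = u then (if j = v then x - w u v else 0) else 0) +
          (w j i + if j = u then (if i = v then x - w u v else 0) else 0)) / 2 - p i) - y i)
          = (if i = u then y i * ((x - w u v) / 2) else 0)
            + (if i = v then y i * ((x - w u v) / 2) else 0) := by
        intro i
        have e2 : ∑ j, ((w i j + if i = u then (if j = v then x - w u v else 0) else 0) +
            (w j i + if j = u then (if i = v then x - w u v else 0) else 0)) / 2 =
            ∑ j, (w i j + w j i) / 2 + ((if i = u then x - w u v else 0) +
              (if i = v then x - w u v else 0)) / 2 := by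
          simp only [← sum_div, sum_add_distrib, sum_ite_irrel, sum_ite_eq', mem_univ, if_true,
            sum_const_zero]
          ring
        rw [e2]
        simp only [hy]
        split_ifs <;> ring
      rw [sum_congr rfl fun i _ => e i] at h
      simp only [sum_add_distrib, sum_ite_eq', mem_univ, if_true] at h
      linarith
    · have := hw.1 i j
      dsimp only
      split_ifs with h1 h2
      · subst h1 h2; linarith
      · linarith
      · linarith
    · have := hw.2 i j
      dsimp only
      split_ifs with h1 h2
      · subst h1 h2; linarith
      · linarith
      · linarith
  have hy0 : ∀ u, y u = 0 := by
    by_contra! hne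
    obtain ⟨u₀, hu₀⟩ := hne
    obtain ⟨q, -, hq⟩ := exists_max_image univ (fun u => |y u|) ⟨u₀, mem_univ _⟩
    set t := |y q| with ht
    have htpos : 0 < t := (abs_pos.2 hu₀).trans_le (hq u₀ (mem_univ _))
    have hle : ∀ u, y u ≤ t := fun u => (le_abs_self _).trans (hq u (mem_univ _))
    have hge : ∀ u, -t ≤ y u := fun u => (abs_le.1 (hq u (mem_univ _))).1
    set S := univ.filter fun u => y u = t with hS
    set T := univ.filter fun u => y u = -t with hT
    have hdisj : Disjoint S T := by
      rw [disjoint_left]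
      intro u hu hu'
      simp only [hS, hT, mem_filter, mem_univ, true_and] at hu hu'
      linarith
    have hST := hcut S T hdisj
    have hwl : ∀ s ∈ S, ∀ v ∈ Tᶜ, (w s v + w v s) / 2 = l s v := by
      intro s hs v hv
      simp only [hS, hT, mem_filter, mem_univ, true_and, mem_compl] at hs hv
      have hlt : 0 < y s + y v := by
        have := lt_of_le_of_ne (hge v) (Ne.symm hv)
        linarith
      have h1 := hwvar s v (l s v) le_rfl (hlc s v)
      have h2 := hwvar v s (l v s) le_rfl (hlc v s)
      have h3 := nonneg_of_mul_nonneg_right h1 hlt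
      have h4 := nonneg_of_mul_nonneg_right h2 (by linarith)
      have h5 := hw.1 s v
      have h6 := hw.1 v s
      have h7 := hl s v
      linarith
    have hwc : ∀ s ∈ T, ∀ v ∈ Sᶜ, (w s v + w v s) / 2 = c s v := by
      intro s hs v hv
      simp only [hS, hT, mem_filter, mem_univ, true_and, mem_compl] at hs hv
      have hlt : y s + y v < 0 := by
        have := lt_of_le_of_ne (hle v) hv
        linarith
      have h1 := hwvar s v (c s v) (hlc s v) le_rfl
      have h2 := hwvar v s (c v s) (hlc v s) le_rfl
      have h5 := hw.2 s v
      have h6 := hw.2 v s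
      have h7 := hc s v
      have h3 : c s v - w s v ≤ 0 := by
        by_contra! h
        nlinarith
      have h4 : c v s - w v s ≤ 0 := by
        by_contra! h
        nlinarith
      linarith
    have hSf : ∀ s ∈ S, ∑ v, (w s v + w v s) / 2 = f s + t := by
      intro s hs
      simp only [hS, mem_filter, mem_univ, true_and] at hs
      have h1 := nonneg_of_mul_nonneg_right (hpvar s (f s) (hgf s) le_rfl) (by linarith)
      have h2 := hp.2 s
      have h3 : p s = f s := le_antisymm h2 (by linarith)
      simp only [hy] at hs
      linarith
    have hTg : ∀ s ∈ T, ∑ v, (w s v + w v s) / 2 = g s - t := by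
      intro s hs
      simp only [hT, mem_filter, mem_univ, true_and] at hs
      have h1 := hpvar s (g s) le_rfl (hgf s)
      have h2 := hp.1 s
      have h3 : p s = g s := by
        apply le_antisymm _ h2
        by_contra! h
        nlinarith
      simp only [hy] at hs
      linarith
    have hcross : ∑ s ∈ S, ∑ v ∈ T, (w s v + w v s) / 2 =
        ∑ s ∈ T, ∑ v ∈ S, (w s v + w v s) / 2 := by
      rw [sum_comm]
      exact sum_congr rfl fun _ _ => sum_congr rfl fun _ _ => by ring
    have eS : ∑ s ∈ S, (f s + t) =
        ∑ s ∈ S, ∑ v ∈ T, (w s v + w v s) / 2 + ∑ s ∈ S, ∑ v ∈ Tᶜ, l s v := by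
      rw [← sum_add_distrib]
      refine sum_congr rfl fun s hs => ?_
      rw [← hSf s hs, ← sum_add_sum_compl T, sum_congr rfl (hwl s hs)]
    have eT : ∑ s ∈ T, (g s - t) =
        ∑ s ∈ T, ∑ v ∈ S, (w s v + w v s) / 2 + ∑ s ∈ T, ∑ v ∈ Sᶜ, c s v := by
      rw [← sum_add_distrib]
      refine sum_congr rfl fun s hs => ?_
      rw [← hTg s hs, ← sum_add_sum_compl S, sum_congr rfl (hwc s hs)]
    rw [sum_add_distrib, sum_const, nsmul_eq_mul] at eS
    rw [sum_sub_distrib, sum_const, nsmul_eq_mul] at eT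
    have hq' : q ∈ S ∨ q ∈ T := by
      simp only [hS, hT, mem_filter, mem_univ, true_and]
      rcases abs_choice (y q) with h | h
      · left; rw [ht, h]
      · right; rw [ht, h]; ring
    have hcard : (1 : ℝ) ≤ (#S : ℝ) + #T := by
      rcases hq' with h | h
      · have : 1 ≤ #S := card_pos.2 ⟨q, h⟩
        exact_mod_cast this.trans (Nat.le_add_right _ _)
      · have : 1 ≤ #T := card_pos.2 ⟨q, h⟩
        exact_mod_cast this.trans (Nat.le_add_left _ _)
    nlinarith
  refine ⟨fun u v => (w u v + w v u) / 2, fun u v => by ring, fun u v => ?_, fun u v => ?_,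
    fun u => ?_⟩
  · have h1 := hw.1 u v
    have h2 := hw.1 v u
    have h3 := hl u v
    dsimp only
    linarith
  · have h1 := hw.2 u v
    have h2 := hw.2 v u
    have h3 := hc u v
    dsimp only
    linarith
  · have h1 := hy0 u
    have h2 := hp.1 u
    have h3 := hp.2 u
    simp only [hy] at h1
    constructor <;> dsimp only <;> linarith

lemma Sym2.card_filter_mk_mem_le {V : Type*} [DecidableEq V]
    (M : Finset (Sym2 V)) (A : Finset V) (u : V) :
    #{v ∈ A | s(u, v) ∈ M} ≤ #M := by
  refine card_le_card_of_injOn (fun v => s(u, v)) ?_ ?_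
  · intro v hv
    simp only [coe_filter, Set.mem_ofPred_eq] at hv
    exact hv.2
  · intro v _ v' _ h
    exact Sym2.congr_right.1 h

lemma Sym2.sum_card_filter_mk_mem_le {V : Type*} [Fintype V] [DecidableEq V]
    {M : Finset (Sym2 V)} (hM : ∀ e ∈ M, ¬ e.IsDiag) (S A : Finset V) :
    ∑ s ∈ S, #{v ∈ A | s(s, v) ∈ M} ≤ 2 * #M := by
  classical
  set H : SimpleGraph V := SimpleGraph.fromEdgeSet (M : Set (Sym2 V)) with hH
  have hcard : #H.edgeFinset ≤ #M := card_le_card fun e he => by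
    have : e ∈ H.edgeSet := by simpa using he
    rw [hH, SimpleGraph.edgeSet_fromEdgeSet] at this
    exact this.1
  calc ∑ s ∈ S, #{v ∈ A | s(s, v) ∈ M} ≤ ∑ s ∈ S, H.degree s := by
        refine sum_le_sum fun s _ => card_le_card fun v hv => ?_
        rw [mem_filter] at hv
        rw [SimpleGraph.mem_neighborFinset, hH, SimpleGraph.fromEdgeSet_adj]
        exact ⟨hv.2, hM _ hv.2⟩
    _ ≤ ∑ s, H.degree s := sum_le_univ_sum_of_nonneg fun _ => Nat.zero_le _
    _ = 2 * #H.edgeFinset := by convert H.sum_degrees_eq_twice_card_edges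
    _ ≤ 2 * #M := Nat.mul_le_mul_left _ hcard

namespace SimpleGraph

variable {V : Type*} [Fintype V] [DecidableEq V] (G : SimpleGraph V) [DecidableRel G.Adj]

lemma sum_incidenceFinset_eq_sum_neighborFinset (h : Sym2 V → ℝ) (u : V) :
    ∑ e ∈ G.incidenceFinset u, h e = ∑ v ∈ G.neighborFinset u, h s(u, v) := by
  symm
  refine sum_bij (fun v _ => s(u, v)) ?_ ?_ ?_ ?_
  · intro v hv
    simpa [mem_incidenceSet] using hv
  · intro v _ v' _ h
    exact Sym2.congr_right.1 h
  · intro e he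
    induction e with
    | h x y =>
      simp only [mem_incidenceFinset, mk'_mem_incidenceSet_iff] at he
      obtain ⟨hxy, rfl | rfl⟩ := he
      · exact ⟨y, by simpa using hxy, rfl⟩
      · exact ⟨x, by simpa using hxy.symm, Sym2.eq_swap⟩
  · intro _ _
    rfl

/-- A cut criterion for the existence of a fractional `[a,b]`-factor with value one on `M`. -/
theorem exists_isFracFactor_of_cut {a b : ℕ} (hab : a ≤ b) (M : Finset (Sym2 V))
    (hM : ↑M ⊆ G.edgeSet)
    (hcut : ∀ S T : Finset V, Disjoint S T →
      a * #T + ∑ s ∈ S, #{v ∈ Tᶜ | s(s, v) ∈ M} ≤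
        b * #S + ∑ t ∈ T, #{v ∈ Sᶜ | G.Adj t v}) :
    ∃ h : Sym2 V → ℝ, G.IsFracFactor a b h ∧ ∀ e ∈ M, h e = 1 := by
  have hadj : ∀ u v, s(u, v) ∈ M → G.Adj u v := fun u v h => hM h
  obtain ⟨w, hsymm, hlw, hwc, hsum⟩ := exists_symm_matrix_of_cut
    (fun u v => if s(u, v) ∈ M then (1 : ℝ) else 0) (fun u v => if G.Adj u v then (1 : ℝ) else 0)
    (fun _ => (a : ℝ)) (fun _ => (b : ℝ))
    (fun u v => by
      dsimp only
      split_ifs with h1 h2 h2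
      · exact le_rfl
      · exact absurd (hadj u v h1) h2
      · exact zero_le_one
      · exact le_rfl)
    (fun _ => Nat.cast_le.2 hab)
    (fun u v => by rw [Sym2.eq_swap]) (fun u v => by simp only [G.adj_comm])
    (fun S T hST => by
      have h := hcut S T hST
      simp only [sum_const, nsmul_eq_mul, sum_boole]
      rw [mul_comm (#T : ℝ), mul_comm (#S : ℝ)]
      exact_mod_cast h)
  refine ⟨Sym2.lift ⟨w, hsymm⟩, ⟨?_, ?_⟩, ?_⟩
  · intro e
    induction e with
    | h u v =>
      intro he
      have h1 := hlw u v
      have h2 := hwc u v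
      have h3 : G.Adj u v := he
      simp only [h3, if_true] at h2
      refine ⟨le_trans ?_ h1, h2⟩
      dsimp only
      split_ifs <;> norm_num
  · intro u
    have e : ∑ e ∈ G.incidenceFinset u, Sym2.lift ⟨w, hsymm⟩ e = ∑ v, w u v := by
      rw [sum_incidenceFinset_eq_sum_neighborFinset]
      refine sum_subset (subset_univ _) fun v _ hv => ?_
      have h3 : ¬ G.Adj u v := by simpa using hv
      have h1 := hlw u v
      have h2 := hwc u v
      have h4 : s(u, v) ∉ M := fun h => h3 (hadj u v h)
      simp only [h3, h4, if_false] at h1 h2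
      exact le_antisymm h2 h1
    rw [e]
    exact hsum u
  · intro e
    induction e with
    | h u v =>
      intro he
      have h1 := hlw u v
      have h2 := hwc u v
      have h3 : G.Adj u v := hadj u v he
      simp only [he, h3, if_true] at h1 h2
      exact le_antisymm h2 h1

lemma degree_le_card_add_card_filter_compl (S : Finset V) (u : V) :
    G.degree u ≤ #S + #{v ∈ Sᶜ | G.Adj u v} := by
  refine (card_le_card fun v hv => ?_).trans (card_union_le _ _)
  by_cases h : v ∈ S <;> simp_all

lemma two_mul_card_edgeFinset_le (T : Finset V) :
    2 * #G.edgeFinset ≤ 2 * ∑ t ∈ T, G.degree t + #Tᶜ * (#Tᶜ - 1) := by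
  have hdeg : ∀ u ∈ Tᶜ, G.degree u ≤ #{v ∈ T | G.Adj u v} + (#Tᶜ - 1) := by
    intro u hu
    rw [← card_erase_of_mem hu]
    refine (card_le_card fun v hv => ?_).trans (card_union_le _ _)
    rw [mem_neighborFinset] at hv
    by_cases h : v ∈ T
    · simp [h, hv]
    · simp [h, hv.ne']
  have hcross : ∑ u ∈ Tᶜ, #{v ∈ T | G.Adj u v} ≤ ∑ t ∈ T, G.degree t := by
    have := sum_card_bipartiteAbove_eq_sum_card_bipartiteBelow (s := Tᶜ) (t := T) G.Adj
    simp only [bipartiteAbove, bipartiteBelow] at this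
    rw [this]
    refine sum_le_sum fun t _ => card_le_card fun v hv => ?_
    rw [mem_filter] at hv
    simpa using hv.2.symm
  have h := sum_le_sum hdeg
  rw [sum_add_distrib, sum_const, smul_eq_mul] at h
  rw [← G.sum_degrees_eq_twice_card_edges, ← sum_add_sum_compl T]
  omega

end SimpleGraph

/-- The arithmetic contradiction between a violated cut and a large number of edges. The cut has
sides of sizes `s` and `t`, `D` edge ends leaving the second side, and `μ` forced edge ends. -/
lemma false_of_violated_cut {a b m n s t D μ E : ℕ} (ha : 2 ≤ a) (hab : a ≤ b) (hm1 : 1 ≤ m)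
    (hmb : m ≤ b) (hn : 8 * a + 5 * b + 8 * m + 14 ≤ 2 * n) (hst : s + t ≤ n)
    (hμ2 : μ ≤ 2 * m) (hμs : μ ≤ m * s) (hD : (a + m) * t ≤ s * t + D)
    (hviol : b * s + D < a * t + μ)
    (hE : (n - b - 1).choose 2 + a * b + 2 * a + (b + 1) * m ≤ E)
    (hE' : 2 * E ≤ 2 * (s * t + D) + (n - t) * (n - t - 1)) : False := by
  have ht : b + 1 ≤ t := by
    by_contra! h
    have h1 : (b - t : ℤ) * s + t * m < μ := by zify at *; nlinarith
    have h2 : (0 : ℤ) ≤ (b - t : ℤ) := by omega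
    have h3 : t ≤ 1 := by
      by_contra! h4
      zify at *
      nlinarith [mul_nonneg h2 (Int.natCast_nonneg s)]
    interval_cases t
    · zify at *
      nlinarith
    · rcases Nat.lt_or_ge s 2 with h4 | h4
      · interval_cases s <;> zify at * <;> nlinarith
      · zify at *
        nlinarith
  obtain ⟨k, rfl⟩ := Nat.exists_eq_add_of_le ht
  obtain ⟨r, rfl⟩ := Nat.exists_eq_add_of_le hst
  have hchoose := Nat.choose_two_right (s + (b + 1 + k) + r - b - 1)
  have heven := Nat.even_mul_pred_self (s + (b + 1 + k) + r - b - 1)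
  have e1 : s + (b + 1 + k) + r - b - 1 = s + k + r := by omega
  have e2 : s + (b + 1 + k) + r - (b + 1 + k) = s + r := by omega
  rw [e1] at hchoose heven hE
  rw [e2] at hE'
  have h2c : 2 * (s + k + r).choose 2 = (s + k + r) * (s + k + r - 1) := by
    rw [hchoose]; exact Nat.two_mul_div_two_of_even heven
  have hsq : ∀ x : ℕ, ((x * (x - 1) : ℕ) : ℤ) = x * x - x := by
    intro x
    cases x <;> simp; ring
  have h2c' : 2 * ((s + k + r).choose 2 : ℤ) = (s + k + r : ℤ) * (s + k + r) - (s + k + r) := by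
    have := hsq (s + k + r)
    rw [← h2c] at this
    push_cast at this
    linarith
  have hE'' : 2 * (E : ℤ) ≤ 2 * (s * (b + 1 + k) + D) + ((s + r) * (s + r) - (s + r)) := by
    have := hsq (s + r)
    zify at hE'
    push_cast at this hE'
    linarith
  clear hchoose heven hE' e1 e2 h2c hsq ht hst hD hμs
  zify at *
  have hD0 : (0 : ℤ) ≤ D := Int.natCast_nonneg D
  have hb2 : (2 : ℤ) ≤ b := by linarith
  have hbm : 2 * (m : ℤ) ≤ b * ((b - 1) * m) := by
    nlinarith [mul_nonneg (by linarith : (0:ℤ) ≤ b - 2) (by linarith : (0:ℤ) ≤ m)]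
  have hs : (s : ℤ) ≤ a + k + (b - 1) * m := by
    by_contra! h
    have h1 : (a : ℤ) + k + (b - 1) * m + 1 ≤ s := h
    have h2 := mul_le_mul_of_nonneg_left h1 (by linarith : (0:ℤ) ≤ b)
    have h3 := mul_le_mul_of_nonneg_right hab (by positivity : (0:ℤ) ≤ 1 + k)
    linarith
  have hs2 : (s : ℤ) ≤ a + k + 2 := by
    by_contra! h
    have h1 : (a : ℤ) + k + 2 + 1 ≤ s := h
    have h2 := mul_le_mul_of_nonneg_left h1 (by linarith : (0:ℤ) ≤ b)
    have h3 := mul_le_mul_of_nonneg_right hab (by positivity : (0:ℤ) ≤ 1 + k)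
    linarith
  have hkr : (2 : ℤ) * a + 3 ≤ k + 2 * r := by omega
  have hk : (0 : ℤ) ≤ k := by positivity
  have h3 := mul_le_mul_of_nonneg_left hkr hk
  have h4 := mul_nonneg (by linarith : (0:ℤ) ≤ b - 2) (by linarith : (0:ℤ) ≤ m)
  linarith

/-- size condition for a connected graph of large order and minimum degree at
least `a + m` to be fractional `(a,b,m)`-covered. -/
theorem size_ge_implies_fracABMCovered
    {V : Type*} [Fintype V] [DecidableEq V] (G : SimpleGraph V) [DecidableRel G.Adj]
    (a b m : ℕ) (ha : 2 ≤ a) (hab : a ≤ b) (hm1 : 1 ≤ m) (hmb : m ≤ b)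
    (hconn : G.Connected)
    (hn : 4 * (a : ℝ) + 5 * (b : ℝ) / 2 + 4 * (m : ℝ) + 7 ≤ (Fintype.card V : ℝ))
    (hδ : ∀ v : V, a + m ≤ G.degree v)
    (he : (Fintype.card V - b - 1).choose 2 + a * b + 2 * a + (b + 1) * m ≤
      G.edgeFinset.card) :
    G.IsFracABMCovered a b m := by
  intro M hM hMm
  refine G.exists_isFracFactor_of_cut hab M hM fun S T hST => ?_
  by_contra! hviol
  have hn' : 8 * a + 5 * b + 8 * m + 14 ≤ 2 * Fintype.card V := by
    have : 8 * (a : ℝ) + 5 * b + 8 * m + 14 ≤ 2 * (Fintype.card V : ℝ) := by linarith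
    exact_mod_cast this
  have hdeg : ∑ t ∈ T, G.degree t ≤ #S * #T + ∑ t ∈ T, #{v ∈ Sᶜ | G.Adj t v} := by
    refine (sum_le_sum fun t _ => G.degree_le_card_add_card_filter_compl S t).trans_eq ?_
    rw [sum_add_distrib, sum_const, smul_eq_mul, mul_comm]
  refine false_of_violated_cut ha hab hm1 hmb hn' ?_ ?_ ?_ (le_trans ?_ hdeg) hviol he ?_
  · rw [← card_union_of_disjoint hST]
    exact card_le_univ _
  · rw [← hMm]
    exact Sym2.sum_card_filter_mk_mem_le (fun e h => G.not_isDiag_of_mem_edgeSet (hM h)) S _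
  · rw [← hMm, mul_comm, ← smul_eq_mul]
    exact sum_le_card_nsmul _ _ _ fun s _ => Sym2.card_filter_mk_mem_le M _ s
  · rw [mul_comm, ← smul_eq_mul]
    exact card_nsmul_le_sum _ _ _ fun t _ => hδ t
  · have h := G.two_mul_card_edgeFinset_le T
    rw [card_compl] at h
    omega
end

section
/- For integers k ≥ 2 and 1 ≤ m ≤ k, let G be a connected finite simple graph of order n ≥ (6k + k² + (k+8)m + 16)/2 with minimum degree δ(G) ≥ k + m. If the spectral radius satisfies ρ(G) ≥ n − k − 1, then G is a fractional (k,k,m)-covered graph. -/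
open Finset

namespace SimpleGraph

variable {V : Type*}

/-- The supremum defining the spectral radius is attained as soon as it is positive. -/
theorem exists_eigenvector_specRad [Fintype V] [DecidableEq V]
    (G : SimpleGraph V) [DecidableRel G.Adj]
    (hpos : 0 < G.specRad) :
    ∃ x : V → ℝ, x ≠ 0 ∧ ∀ u, ∑ v ∈ G.neighborFinset u, x v = G.specRad * x u := by
  have hdec : (Classical.decRel G.Adj) = ‹DecidableRel G.Adj› := Subsingleton.elim _ _
  have hdef : G.specRad =
      sSup {μ : ℝ | Module.End.HasEigenvalue (Matrix.toLin' (G.adjMatrix ℝ)) μ} := by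
    rw [specRad, hdec]
  have hne : {μ : ℝ | Module.End.HasEigenvalue (Matrix.toLin' (G.adjMatrix ℝ)) μ}.Nonempty := by
    by_contra h
    rw [Set.not_nonempty_iff_eq_empty] at h
    rw [hdef, h, Real.sSup_empty] at hpos
    exact hpos.false
  have hmem := hne.csSup_mem (Module.End.finite_hasEigenvalue _)
  rw [← hdef] at hmem
  obtain ⟨x, hx⟩ := Module.End.HasEigenvalue.exists_hasEigenvector hmem
  refine ⟨x, hx.2, fun u => ?_⟩
  have := congrFun hx.apply_eq_smul u
  simpa [Matrix.toLin'_apply, adjMatrix_mulVec_apply] using this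

/-- Double counting over ordered adjacent pairs. -/
theorem sum_neighborFinset_comm [Fintype V] (G : SimpleGraph V) [DecidableRel G.Adj] (F : V → V → ℝ) :
    ∑ u, ∑ v ∈ G.neighborFinset u, F u v = ∑ u, ∑ v ∈ G.neighborFinset u, F v u := by
  refine Finset.sum_comm' fun u v => ?_
  simp [adj_comm]

/-- A form of the Hong–Shu–Fang bound: a lower bound on the spectral radius forces many edges. -/
theorem mul_le_sum_degrees_sub [Fintype V] [DecidableEq V]
    (G : SimpleGraph V) [DecidableRel G.Adj] (d r : ℝ)
    (hd : ∀ v, d ≤ G.degree v) (hr0 : 0 < r) (hrd : d - 1 ≤ r) (hr : r ≤ G.specRad) :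
    r * (r - (d - 1)) ≤ ∑ v, (G.degree v : ℝ) - ((Fintype.card V : ℝ) - 1) * d := by
  obtain ⟨x, hx0, hx⟩ := G.exists_eigenvector_specRad (hr0.trans_le hr)
  set ρ := G.specRad
  have hρ0 : 0 < ρ := hr0.trans_le hr
  have hy : ∀ u, ρ * |x u| ≤ ∑ v ∈ G.neighborFinset u, |x v| := fun u => by
    calc ρ * |x u| = |∑ v ∈ G.neighborFinset u, x v| := by rw [hx u, abs_mul, abs_of_pos hρ0]
      _ ≤ _ := Finset.abs_sum_le_sum_abs _ _
  have hsum : 0 < ∑ u, |x u| := by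
    obtain ⟨u, hu⟩ := Function.ne_iff.mp hx0
    exact Finset.sum_pos' (fun _ _ => abs_nonneg _) ⟨u, Finset.mem_univ _, abs_pos.mpr hu⟩
  have hdeg : ∑ u, ∑ v ∈ G.neighborFinset u, |x v| = ∑ u, (G.degree u : ℝ) * |x u| := by
    rw [G.sum_neighborFinset_comm fun _ v => |x v|]
    simp
  have hdeg2 : ∑ u, (G.degree u : ℝ) * ∑ v ∈ G.neighborFinset u, |x v|
      = ∑ u, (∑ v ∈ G.neighborFinset u, (G.degree v : ℝ)) * |x u| := by
    simp_rw [Finset.mul_sum, Finset.sum_mul]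
    exact G.sum_neighborFinset_comm fun u v => (G.degree u : ℝ) * |x v|
  have hlow : ρ * (ρ - (d - 1)) * ∑ u, |x u| ≤
      ∑ u, ((G.degree u : ℝ) - (d - 1)) * ∑ v ∈ G.neighborFinset u, |x v| := by
    calc ρ * (ρ - (d - 1)) * ∑ u, |x u|
        = ρ * (∑ u, ρ * |x u| - (d - 1) * ∑ u, |x u|) := by rw [← Finset.mul_sum]; ring
      _ ≤ ρ * (∑ u, (G.degree u : ℝ) * |x u| - (d - 1) * ∑ u, |x u|) := by
          rw [← hdeg]
          gcongr with u
          exact hy u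
      _ = ∑ u, ((G.degree u : ℝ) - (d - 1)) * (ρ * |x u|) := by
          rw [Finset.mul_sum, ← Finset.sum_sub_distrib, Finset.mul_sum]
          exact Finset.sum_congr rfl fun u _ => by ring
      _ ≤ _ := by
          refine Finset.sum_le_sum fun u _ => mul_le_mul_of_nonneg_left (hy u) ?_
          linarith [hd u]
  have hrow : ∀ u, ∑ v ∈ G.neighborFinset u, (G.degree v : ℝ) ≤
      ∑ v, (G.degree v : ℝ) - ((Fintype.card V : ℝ) - 1) * d + (d - 1) * G.degree u := fun u => by
    have hsplit : ∑ v, ((G.degree v : ℝ) - d) ≥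
        ∑ v ∈ insert u (G.neighborFinset u), ((G.degree v : ℝ) - d) :=
      Finset.sum_le_sum_of_subset_of_nonneg (Finset.subset_univ _) fun v _ _ => by
        linarith [hd v]
    rw [Finset.sum_insert (by simp), Finset.sum_sub_distrib, Finset.sum_sub_distrib] at hsplit
    simp only [Finset.sum_const, Finset.card_univ, nsmul_eq_mul, card_neighborFinset_eq_degree]
      at hsplit
    linarith
  have hup : ∑ u, ((G.degree u : ℝ) - (d - 1)) * ∑ v ∈ G.neighborFinset u, |x v| ≤
      (∑ v, (G.degree v : ℝ) - ((Fintype.card V : ℝ) - 1) * d) * ∑ u, |x u| := by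
    simp_rw [sub_mul _ (d - 1)]
    rw [Finset.sum_sub_distrib, hdeg2, ← Finset.mul_sum, hdeg, Finset.mul_sum, Finset.mul_sum,
      ← Finset.sum_sub_distrib]
    refine Finset.sum_le_sum fun u _ => ?_
    nlinarith [mul_le_mul_of_nonneg_right (hrow u) (abs_nonneg (x u))]
  have hmain := le_of_mul_le_mul_right (hlow.trans hup) hsum
  nlinarith

/-- The maximal contribution `z * h e` of an edge `e` over `0 ≤ h e ≤ 1`, where `h e = 1` is
forced if `e ∈ M`. -/
noncomputable def edgeSupport [DecidableEq V] (M : Finset (Sym2 V)) (e : Sym2 V) (z : ℝ) : ℝ :=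
  if e ∈ M then z else max z 0

theorem sum_incidenceFinset_eq [Fintype V] [DecidableEq V]
    (G : SimpleGraph V) [DecidableRel G.Adj] (h : Sym2 V → ℝ) (u : V) :
    ∑ e ∈ G.incidenceFinset u, h e = ∑ v ∈ G.neighborFinset u, h s(u, v) := by
  symm
  refine Finset.sum_bij (fun v _ => s(u, v)) (fun v hv => ?_) (fun v _ v' _ h => ?_)
    (fun e he => ?_) fun _ _ => rfl
  · simpa [mem_incidenceFinset, mk'_mem_incidenceSet_left_iff] using hv
  · exact Sym2.congr_right.mp h
  · rw [mem_incidenceFinset] at he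
    obtain ⟨v, rfl⟩ := Sym2.mem_iff_exists.mp he.2
    exact ⟨v, by simpa using he.1, rfl⟩

theorem two_mul_sum_mul_sum_incidenceFinset [Fintype V] [DecidableEq V]
    (G : SimpleGraph V) [DecidableRel G.Adj]
    (h : Sym2 V → ℝ) (y : V → ℝ) :
    2 * ∑ u, y u * ∑ e ∈ G.incidenceFinset u, h e =
      ∑ u, ∑ v ∈ G.neighborFinset u, (y u + y v) * h s(u, v) := by
  simp_rw [sum_incidenceFinset_eq, add_mul, Finset.sum_add_distrib]
  simp_rw [Finset.mul_sum (G.neighborFinset _)]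
  rw [G.sum_neighborFinset_comm fun u v => y v * h s(u, v), two_mul]
  congr 1
  exact Finset.sum_congr rfl fun u _ => Finset.sum_congr rfl fun v _ => by rw [Sym2.eq_swap]

/-- Linear programming duality for fractional factors that are forced to be `1` on `M`. -/
theorem exists_isFracFactor_of_forall_le [Fintype V] [DecidableEq V]
    (G : SimpleGraph V) [DecidableRel G.Adj] (k : ℕ)
    (M : Finset (Sym2 V))
    (hM : ∀ y : V → ℝ, 2 * ∑ u, y u * k ≤
      ∑ u, ∑ v ∈ G.neighborFinset u, edgeSupport M s(u, v) (y u + y v)) :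
    ∃ h : Sym2 V → ℝ, G.IsFracFactor k k h ∧ ∀ e ∈ M, h e = 1 := by
  let lo : Sym2 V → ℝ := fun e => if e ∈ M then 1 else 0
  have hlo : ∀ e, 0 ≤ lo e ∧ lo e ≤ 1 := fun e => by
    simp only [lo]; split_ifs <;> norm_num
  let L : (Sym2 V → ℝ) →ₗ[ℝ] (V → ℝ) :=
    { toFun := fun h u => ∑ e ∈ G.incidenceFinset u, h e
      map_add' := fun _ _ => funext fun _ => Finset.sum_add_distrib
      map_smul' := fun _ _ => funext fun _ => (Finset.mul_sum _ _ _).symm }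
  have hcomp : IsCompact (L '' Set.Icc lo 1) :=
    isCompact_Icc.image L.continuous_of_finiteDimensional
  have hconv : Convex ℝ (L '' Set.Icc lo 1) := (convex_Icc lo 1).linear_image L
  by_cases hk : (fun _ => (k : ℝ)) ∈ L '' Set.Icc lo 1
  · obtain ⟨h, ⟨hl, hu⟩, hh⟩ := hk
    refine ⟨h, ⟨fun e _ => ⟨(hlo e).1.trans (hl e), hu e⟩, fun u => ?_⟩, fun e he => ?_⟩
    · have := congrFun hh u
      exact ⟨this.ge, this.le⟩
    · refine le_antisymm (hu e) ?_
      simpa [lo, he] using hl e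
  · exfalso
    obtain ⟨f, a, hfa, haf⟩ := geometric_hahn_banach_closed_point hconv hcomp.isClosed hk
    let y : V → ℝ := fun u => f (Pi.single u 1)
    have hf : ∀ x : V → ℝ, f x = ∑ u, y u * x u := fun x => by
      rw [← ContinuousLinearMap.coe_coe, LinearMap.pi_apply_eq_sum_univ f.toLinearMap x]
      refine Finset.sum_congr rfl fun u _ => ?_
      rw [smul_eq_mul, mul_comm]
      congr 1
      exact congrArg f (funext fun v => by simp [Pi.single_apply, eq_comm])
    let pos : Sym2 V → Prop :=
      Sym2.fromRel (r := fun u v => 0 < y u + y v) ⟨fun u v h => by rwa [add_comm]⟩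
    classical
    let h : Sym2 V → ℝ := fun e => if e ∈ M ∨ pos e then 1 else 0
    have hh : h ∈ Set.Icc lo 1 := by
      constructor <;> intro e <;> simp only [h, lo, Pi.one_apply] <;> split_ifs <;>
        first | tauto | norm_num
    have h1 := hfa _ ⟨h, hh, rfl⟩
    have h2 := h1.trans haf
    rw [hf, hf] at h2
    have h3 := G.two_mul_sum_mul_sum_incidenceFinset h y
    have h4 : ∑ u, ∑ v ∈ G.neighborFinset u, (y u + y v) * h s(u, v) =
        ∑ u, ∑ v ∈ G.neighborFinset u, edgeSupport M s(u, v) (y u + y v) := by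
      refine Finset.sum_congr rfl fun u _ => Finset.sum_congr rfl fun v _ => ?_
      have hp : pos s(u, v) ↔ 0 < y u + y v := Iff.rfl
      simp only [h, edgeSupport, hp]
      by_cases hm : s(u, v) ∈ M
      · simp [hm]
      · by_cases hq : 0 < y u + y v
        · simp [hm, hq, hq.le]
        · simp [hm, hq, not_lt.mp hq]
    have h5 := hM y
    have h6 : L h = fun u => ∑ e ∈ G.incidenceFinset u, h e := rfl
    rw [h6] at h2
    linarith

/-- Peeling off a multiple of the sign pattern of `y` is compatible with `edgeSupport`. -/
theorem edgeSupport_add [DecidableEq V] (M : Finset (Sym2 V)) (e : Sym2 V) {a y z : ℝ} (ha : 0 ≤ a)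
    (hy : y ≠ 0 → a ≤ |y|) (hz : z ≠ 0 → a ≤ |z|) :
    edgeSupport M e (y + z) = edgeSupport M e ((y - a * SignType.sign y) +
      (z - a * SignType.sign z)) + a * edgeSupport M e (SignType.sign y + SignType.sign z) := by
  unfold edgeSupport
  split_ifs
  · ring
  rcases lt_trichotomy y 0 with h | h | h <;> rcases lt_trichotomy z 0 with h' | h' | h' <;>
    simp only [h, h', sign_neg, sign_pos, sign_zero, SignType.coe_neg, SignType.coe_one,
      SignType.coe_zero] <;>
    (try have hy := hy h.ne) <;> (try have hy := hy h.ne') <;>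
    (try have hz := hz h'.ne) <;> (try have hz := hz h'.ne') <;>
    (try rw [abs_of_neg h] at hy) <;> (try rw [abs_of_pos h] at hy) <;>
    (try rw [abs_of_neg h'] at hz) <;> (try rw [abs_of_pos h'] at hz) <;>
    norm_num <;> grind

theorem forall_le_of_forall_sign_le [Fintype V] [DecidableEq V]
    (G : SimpleGraph V) [DecidableRel G.Adj] (k : ℕ)
    (M : Finset (Sym2 V))
    (hM : ∀ y : V → SignType, 2 * ∑ u, (y u : ℝ) * k ≤
      ∑ u, ∑ v ∈ G.neighborFinset u, edgeSupport M s(u, v) (y u + y v)) (y : V → ℝ) :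
    2 * ∑ u, y u * k ≤
      ∑ u, ∑ v ∈ G.neighborFinset u, edgeSupport M s(u, v) (y u + y v) := by
  induction hc : #{u | y u ≠ 0} using Nat.strong_induction_on generalizing y with
  | _ c ih =>
  by_cases hne : ({u | y u ≠ 0} : Finset V).Nonempty
  · obtain ⟨w, hw, hmin⟩ := Finset.exists_min_image _ (fun u => |y u|) hne
    have ha : ∀ u, y u ≠ 0 → |y w| ≤ |y u| := fun u hu => hmin u (by simpa using hu)
    have hw : y w ≠ 0 := by simpa using hw
    let z : V → ℝ := fun u => y u - |y w| * SignType.sign (y u)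
    have hz := ih _ (by
      rw [← hc]
      refine Finset.card_lt_card ⟨fun u hu => ?_, fun h => ?_⟩
      · simp only [Finset.mem_filter_univ] at hu ⊢
        exact fun h0 => hu (by simp [z, h0])
      · have := h (show w ∈ _ by simpa using hw)
        simp only [Finset.mem_filter_univ] at this
        exact this (by simp only [z, abs_mul_sign, sub_self])) z rfl
    have hs := mul_le_mul_of_nonneg_left (hM fun u => SignType.sign (y u)) (abs_nonneg (y w))
    have hl : 2 * ∑ u, y u * k = 2 * ∑ u, z u * k +
        |y w| * (2 * ∑ u, ((SignType.sign (y u) : SignType) : ℝ) * k) := by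
      rw [mul_left_comm, ← mul_add, Finset.mul_sum (a := |y w|), ← Finset.sum_add_distrib]
      congr 1
      exact Finset.sum_congr rfl fun u _ => by simp only [z]; ring
    rw [hl]
    refine (add_le_add hz hs).trans_eq ?_
    simp_rw [Finset.mul_sum, ← Finset.sum_add_distrib]
    refine Finset.sum_congr rfl fun u _ => Finset.sum_congr rfl fun v _ => ?_
    exact (edgeSupport_add M _ (abs_nonneg _) (ha u) (ha v)).symm
  · have hy : ∀ u, y u = 0 := by simpa [Finset.not_nonempty_iff_eq_empty,
      Finset.filter_eq_empty_iff] using hne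
    simp [hy, edgeSupport]

/-- The arithmetic behind the degree-sum contradiction. -/
theorem degree_sum_arith {n k m s t D : ℝ} (hk : 2 ≤ k) (hm1 : 1 ≤ m) (hmk : m ≤ k)
    (hst : s + t ≤ n) (hs : s ≤ t + 1) (ht : k + 1 ≤ t)
    (hk3 : 0 ≤ (k - 2) * (k - 3)) (hn : 6 * k + k ^ 2 + (k + 8) * m + 16 ≤ 2 * n)
    (hD : D < k * t - k * s + 2 * m)
    (hlow : (n - k - 1) * (n - k - 1 - (k + m - 1)) ≤
      2 * D + t * s + s * n + (n - s - t) * (n - t) - (n - t) - (n - 1) * (k + m)) : False := by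
  have h1 : t * (t - 1) + 2 * (n - s - t) * t - 2 * k * t + 2 * k * s - 4 * m <
      2 * k * n - 2 * k ^ 2 - k * m - k := by nlinarith
  rcases le_total (2 * t + 1) n with h | h
  · have h2 : 0 ≤ (t + 1 - s) * (t - k) := mul_nonneg (by linarith) (by linarith)
    have h3 : 0 ≤ (t - k - 1) * (n - 1 - 2 * t) := mul_nonneg (by linarith) (by linarith)
    have h4 : 0 ≤ (t - k - 1) * (n / 2 - 3 * k - 9 / 2) :=
      mul_nonneg (by linarith) (by nlinarith)
    nlinarith
  · have h2 : 0 ≤ (n - s - t) * (t - k) := mul_nonneg (by linarith) (by linarith)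
    have h3 : 0 ≤ (k - 2) * (m - 1) := mul_nonneg (by linarith) (by linarith)
    have h4 : 7 / 2 * k + 12 / 5 ≤ t := by nlinarith [sq_nonneg (k - 7 / 2)]
    have h5 : 0 ≤ (t - (7 / 2 * k + 12 / 5)) * (t + (7 / 2 * k + 12 / 5) - 4 * k - 1) :=
      mul_nonneg (by linarith) (by linarith)
    nlinarith [sq_nonneg (k - 3)]

/-- The number of edges of `M` at a vertex, counted through neighbours. -/
theorem card_filter_neighborFinset_le [Fintype V] [DecidableEq V]
    (G : SimpleGraph V) [DecidableRel G.Adj] (M : Finset (Sym2 V)) (u : V) :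
    #{v ∈ G.neighborFinset u | s(u, v) ∈ M} ≤ #{e ∈ M | u ∈ e} := by
  refine Finset.card_le_card_of_injOn (fun v => s(u, v)) (fun v hv => ?_)
    fun v _ v' _ h => Sym2.congr_right.mp h
  simp only [Finset.coe_filter, Set.mem_ofPred_eq] at hv ⊢
  exact ⟨hv.2, Sym2.mem_mk_left u v⟩

theorem sum_card_filter_neighborFinset_le [Fintype V] [DecidableEq V]
    (G : SimpleGraph V) [DecidableRel G.Adj] (M : Finset (Sym2 V)) :
    ∑ u, #{v ∈ G.neighborFinset u | s(u, v) ∈ M} ≤ 2 * #M := by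
  calc ∑ u, #{v ∈ G.neighborFinset u | s(u, v) ∈ M}
      ≤ ∑ u, #{e ∈ M | u ∈ e} := Finset.sum_le_sum fun u _ => G.card_filter_neighborFinset_le M u
    _ = ∑ e ∈ M, #{u | u ∈ e} := Finset.sum_card_bipartiteAbove_eq_sum_card_bipartiteBelow _
    _ ≤ ∑ e ∈ M, 2 := by
        refine Finset.sum_le_sum fun e _ => ?_
        induction e with | _ a b =>
        refine (Finset.card_le_card (t := {a, b}) fun u hu => ?_).trans Finset.card_le_two
        simpa using hu
    _ = 2 * #M := by rw [Finset.sum_const, smul_eq_mul, mul_comm]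

/-- Lower bound for the support function at a sign pattern, in terms of the degrees, outside the
negative part, of the vertices of the positive part. -/
theorem two_mul_sum_sub_le_sum_edgeSupport [Fintype V] [DecidableEq V]
    (G : SimpleGraph V) [DecidableRel G.Adj] (M : Finset (Sym2 V)) (S T : Finset V)
    (y : V → SignType) (hT : ∀ u, u ∈ T ↔ y u = 1) (hS : ∀ u, u ∈ S ↔ y u = -1) (β : ℝ)
    (hβ : 2 * #M ≤ β ∨ #M * #S ≤ β) :
    2 * ∑ u ∈ T, (#(G.neighborFinset u \ S) : ℝ) - 2 * β ≤
      ∑ u, ∑ v ∈ G.neighborFinset u, edgeSupport M s(u, v) (y u + y v) := by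
  let c : V → V → ℝ := fun u v => if u ∈ T ∧ v ∉ S then 1 else 0
  let b : V → V → ℝ := fun u v => if s(u, v) ∈ M then max (-((y u : ℝ) + y v)) 0 else 0
  have hpt : ∀ u v, edgeSupport M s(u, v) ((y u : ℝ) + y v) = c u v + c v u - b u v := by
    intro u v
    simp only [edgeSupport, c, b, hT, hS]
    cases hu : y u <;> cases hv : y v <;> by_cases hm : s(u, v) ∈ M <;> simp [hm]
  have hc : ∑ u, ∑ v ∈ G.neighborFinset u, c u v = ∑ u ∈ T, (#(G.neighborFinset u \ S) : ℝ) := by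
    rw [← Finset.sum_subset (Finset.subset_univ T)]
    · refine Finset.sum_congr rfl fun u hu => ?_
      simp only [c, hu, true_and, Finset.sum_boole, Finset.filter_notMem_eq_sdiff]
    · intro u _ hu
      simp [c, hu]
  have hb : ∑ u, ∑ v ∈ G.neighborFinset u, b u v ≤ 2 * β := by
    rcases hβ with h | h
    · calc ∑ u, ∑ v ∈ G.neighborFinset u, b u v
          ≤ ∑ u, ∑ v ∈ G.neighborFinset u, 2 * (if s(u, v) ∈ M then 1 else 0) := by
            refine Finset.sum_le_sum fun u _ => Finset.sum_le_sum fun v _ => ?_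
            simp only [b]
            cases hu : y u <;> cases hv : y v <;> split_ifs <;> norm_num
        _ = 2 * ((∑ u, #{v ∈ G.neighborFinset u | s(u, v) ∈ M} : ℕ) : ℝ) := by
            simp_rw [← Finset.mul_sum, Finset.sum_boole]
            push_cast
            rfl
        _ ≤ 2 * ((2 * #M : ℕ) : ℝ) := by
            gcongr
            exact G.sum_card_filter_neighborFinset_le M
        _ ≤ 2 * β := by push_cast; linarith
    · let g : V → V → ℝ := fun u v => if u ∈ S then (if s(u, v) ∈ M then 1 else 0) else 0
      have hg : ∑ u, ∑ v ∈ G.neighborFinset u, g u v ≤ β := by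
        calc ∑ u, ∑ v ∈ G.neighborFinset u, g u v
            = ∑ u ∈ S, (#{v ∈ G.neighborFinset u | s(u, v) ∈ M} : ℝ) := by
              rw [← Finset.sum_subset (Finset.subset_univ S)]
              · refine Finset.sum_congr rfl fun u hu => ?_
                simp only [g, hu, if_true, Finset.sum_boole]
              · intro u _ hu
                simp [g, hu]
          _ ≤ ∑ u ∈ S, (#M : ℝ) := by
              refine Finset.sum_le_sum fun u _ => ?_
              exact_mod_cast (G.card_filter_neighborFinset_le M u).trans (Finset.card_filter_le _ _)
          _ ≤ β := by rw [Finset.sum_const, nsmul_eq_mul, mul_comm]; exact h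
      calc ∑ u, ∑ v ∈ G.neighborFinset u, b u v
          ≤ ∑ u, ∑ v ∈ G.neighborFinset u, (g u v + g v u) := by
            refine Finset.sum_le_sum fun u _ => Finset.sum_le_sum fun v _ => ?_
            have hsw : s(v, u) = s(u, v) := Sym2.eq_swap
            simp only [b, g, hS, hsw]
            cases hu : y u <;> cases hv : y v <;> split_ifs <;> simp_all
        _ = 2 * ∑ u, ∑ v ∈ G.neighborFinset u, g u v := by
            simp_rw [Finset.sum_add_distrib]
            rw [← G.sum_neighborFinset_comm g, two_mul]
        _ ≤ 2 * β := by linarith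
  simp_rw [hpt, Finset.sum_sub_distrib, Finset.sum_add_distrib]
  rw [← G.sum_neighborFinset_comm c, hc]
  linarith

/-- Upper bound for the degree sum in terms of the degrees, outside `S`, of the vertices
of `T`. -/
theorem sum_degrees_le [Fintype V] [DecidableEq V]
    (G : SimpleGraph V) [DecidableRel G.Adj] {S T : Finset V} (hST : Disjoint S T) :
    ∑ v, (G.degree v : ℝ) ≤ 2 * ∑ u ∈ T, (#(G.neighborFinset u \ S) : ℝ) + #T * #S +
      #S * Fintype.card V + ((Fintype.card V : ℝ) - #S - #T) * (Fintype.card V - #T) -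
      (Fintype.card V - #T) := by
  have hU : (#(univ \ (S ∪ T)) : ℝ) = Fintype.card V - #S - #T := by
    rw [Finset.cast_card_sdiff (Finset.subset_univ _), Finset.card_union_of_disjoint hST,
      Finset.card_univ]
    push_cast; ring
  have hsplit : ∀ F : V → ℝ, ∑ v, F v =
      ∑ v ∈ S, F v + ∑ v ∈ T, F v + ∑ v ∈ univ \ (S ∪ T), F v := by
    intro F
    rw [← Finset.sum_union hST, add_comm, Finset.sum_sdiff (Finset.subset_univ _)]
  have h1 : ∑ v ∈ S, (G.degree v : ℝ) ≤ #S * (Fintype.card V - 1) := by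
    rw [← nsmul_eq_mul]
    refine Finset.sum_le_card_nsmul _ _ _ fun v _ => ?_
    have : ((G.degree v + 1 : ℕ) : ℝ) ≤ Fintype.card V := by exact_mod_cast G.degree_lt_card_verts v
    push_cast at this; linarith
  have h2 : ∑ v ∈ T, (G.degree v : ℝ) ≤
      ∑ u ∈ T, (#(G.neighborFinset u \ S) : ℝ) + #T * #S := by
    rw [← nsmul_eq_mul, ← Finset.sum_const, ← Finset.sum_add_distrib]
    refine Finset.sum_le_sum fun v _ => ?_
    rw [← card_neighborFinset_eq_degree]
    have := Finset.le_card_sdiff S (G.neighborFinset v)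
    have h : #(G.neighborFinset v) ≤ #(G.neighborFinset v \ S) + #S := by omega
    exact_mod_cast h
  have h3 : ∑ v ∈ univ \ (S ∪ T), (G.degree v : ℝ) ≤
      ((Fintype.card V : ℝ) - #S - #T) * (Fintype.card V - #T - 1) +
        ∑ u ∈ T, (#(G.neighborFinset u \ S) : ℝ) := by
    have h4 : ∀ v ∈ univ \ (S ∪ T), (G.degree v : ℝ) ≤
        (Fintype.card V - #T - 1) + #{u ∈ T | G.Adj v u} := by
      intro v hv
      have h6 := Finset.card_union_add_card_inter (G.neighborFinset v) (insert v T)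
      have h7 : G.neighborFinset v ∩ insert v T = {u ∈ T | G.Adj v u} := by
        ext u
        simp only [Finset.mem_inter, mem_neighborFinset, Finset.mem_insert, Finset.mem_filter]
        constructor
        · rintro ⟨h, rfl | h'⟩
          · exact (G.irrefl h).elim
          · exact ⟨h', h⟩
        · exact fun h => ⟨h.2, Or.inr h.1⟩
      have h8 : v ∉ T := by simp at hv; tauto
      rw [h7, Finset.card_insert_of_notMem h8, card_neighborFinset_eq_degree] at h6
      have h9 := Finset.card_le_univ (G.neighborFinset v ∪ insert v T)
      have : ((G.degree v + (#T + 1) : ℕ) : ℝ) ≤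
        ((Fintype.card V + #{u ∈ T | G.Adj v u} : ℕ) : ℝ) := by exact_mod_cast (by omega)
      push_cast at this
      linarith
    refine (Finset.sum_le_sum h4).trans ?_
    rw [Finset.sum_add_distrib, Finset.sum_const, nsmul_eq_mul, hU]
    gcongr
    have h10 : ∑ v ∈ univ \ (S ∪ T), #{u ∈ T | G.Adj v u} =
        ∑ u ∈ T, #{v ∈ univ \ (S ∪ T) | G.Adj v u} :=
      Finset.sum_card_bipartiteAbove_eq_sum_card_bipartiteBelow _
    have h11 : ∑ u ∈ T, #{v ∈ univ \ (S ∪ T) | G.Adj v u} ≤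
        ∑ u ∈ T, #(G.neighborFinset u \ S) := by
      refine Finset.sum_le_sum fun u _ => Finset.card_le_card fun v hv => ?_
      simp only [Finset.mem_filter, Finset.mem_sdiff, Finset.mem_univ, Finset.mem_union,
        mem_neighborFinset, true_and, not_or] at hv ⊢
      exact ⟨hv.2.symm, hv.1.1⟩
    exact_mod_cast h10.trans_le h11
  rw [hsplit]
  nlinarith

end SimpleGraph

/-- spectral radius condition for a connected graph of large order and minimum
degree at least `k + m` to be fractional `(k,k,m)`-covered. -/
theorem specRad_ge_implies_fracKKMCovered
    {V : Type*} [Fintype V] [DecidableEq V] (G : SimpleGraph V) [DecidableRel G.Adj]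
    (k m : ℕ) (hk : 2 ≤ k) (hm1 : 1 ≤ m) (hmk : m ≤ k)
    (hconn : G.Connected)
    (hn : ((6 * k + k ^ 2 + (k + 8) * m + 16 : ℕ) : ℝ) / 2 ≤ (Fintype.card V : ℝ))
    (hδ : ∀ v : V, k + m ≤ G.degree v)
    (hρ : (Fintype.card V : ℝ) - (k : ℝ) - 1 ≤ G.specRad) :
    G.IsFracABMCovered k k m := by
  intro M hMG hMm
  refine G.exists_isFracFactor_of_forall_le k M (G.forall_le_of_forall_sign_le k M fun y => ?_)
  set S : Finset V := {u | y u = -1}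
  set T : Finset V := {u | y u = 1}
  have hS : ∀ u, u ∈ S ↔ y u = -1 := by simp [S]
  have hT : ∀ u, u ∈ T ↔ y u = 1 := by simp [T]
  have hST : Disjoint S T := by
    refine Finset.disjoint_left.mpr fun u h h' => ?_
    rw [hS] at h
    rw [hT, h] at h'
    exact absurd h' (by decide)
  have hsum : ∑ u, (y u : ℝ) * k = #T * k - #S * k := by
    have : ∀ u, (y u : ℝ) = (if y u = 1 then 1 else 0) - (if y u = -1 then 1 else 0) := fun u => by
      cases h : y u <;> simp
    rw [← Finset.sum_mul, Finset.sum_congr rfl fun u _ => this u, Finset.sum_sub_distrib,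
      Finset.sum_boole, Finset.sum_boole, sub_mul]
  rw [hsum]
  by_contra! hlt
  have hβ1 := G.two_mul_sum_sub_le_sum_edgeSupport M S T y hT hS (2 * #M) (Or.inl le_rfl)
  have hβ2 := G.two_mul_sum_sub_le_sum_edgeSupport M S T y hT hS (#M * #S) (Or.inr le_rfl)
  have hub := G.sum_degrees_le hST
  have hD1 : (#T : ℝ) * (k + m - #S) ≤ ∑ u ∈ T, (#(G.neighborFinset u \ S) : ℝ) := by
    rw [← nsmul_eq_mul]
    refine Finset.card_nsmul_le_sum _ _ _ fun v _ => ?_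
    have h1 := Finset.le_card_sdiff S (G.neighborFinset v)
    have h2 := hδ v
    rw [← SimpleGraph.card_neighborFinset_eq_degree] at h2
    have h : ((k + m : ℕ) : ℝ) ≤ ((#(G.neighborFinset v \ S) + #S : ℕ) : ℝ) := by
      exact_mod_cast (by omega)
    push_cast at h
    linarith
  have hD0 : (0 : ℝ) ≤ ∑ u ∈ T, (#(G.neighborFinset u \ S) : ℝ) :=
    Finset.sum_nonneg fun _ _ => Nat.cast_nonneg _
  have hcard : #S + #T ≤ Fintype.card V := by
    rw [← Finset.card_union_of_disjoint hST]
    exact Finset.card_le_univ _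
  rw [hMm] at hβ1 hβ2
  generalize (∑ u ∈ T, (#(G.neighborFinset u \ S) : ℝ)) = D at *
  generalize #S = s at *
  generalize #T = t at *
  have hv1 : D < k * t - k * s + 2 * m := by linarith
  have hv2 : D < k * t - k * s + m * s := by linarith
  clear hβ1 hβ2 hlt
  have hk' : (2 : ℝ) ≤ k := by exact_mod_cast hk
  have hm1' : (1 : ℝ) ≤ m := by exact_mod_cast hm1
  have hmk' : (m : ℝ) ≤ k := by exact_mod_cast hmk
  have hs0 : (0 : ℝ) ≤ s := Nat.cast_nonneg s
  have hcard' : (s : ℝ) + t ≤ Fintype.card V := by exact_mod_cast hcard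
  have hst : s ≤ t + 1 := by
    have h : (s : ℝ) < t + 2 := by nlinarith
    have h : s < t + 2 := by exact_mod_cast h
    omega
  have hst' : (s : ℝ) ≤ t + 1 := by exact_mod_cast hst
  push_cast at hn
  by_cases htk : t ≤ k
  · have htk' : (t : ℝ) ≤ k := by exact_mod_cast htk
    have h1 : ((k : ℝ) - t) * s + t * m < 2 * m := by nlinarith
    have h2 : ((k : ℝ) - t) * s + t * m < m * s := by nlinarith
    have ht2 : t < 2 := by
      by_contra! h
      have h' : (2 : ℝ) ≤ t := by exact_mod_cast h
      nlinarith [mul_nonneg (sub_nonneg.mpr htk') hs0]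
    interval_cases t
    · norm_num at h2
      nlinarith
    · interval_cases s <;> norm_num at h1 h2 <;> linarith
  · have ht : (k : ℝ) + 1 ≤ t := by exact_mod_cast (by omega : k + 1 ≤ t)
    have hk3 : (0 : ℝ) ≤ (k - 2) * (k - 3) := by
      rcases hk.eq_or_lt with rfl | h
      · norm_num
      · have : (3 : ℝ) ≤ k := by exact_mod_cast h
        exact mul_nonneg (by linarith) (by linarith)
    have hkm : (0 : ℝ) ≤ k * m := by positivity
    have hlow := G.mul_le_sum_degrees_sub (k + m) (Fintype.card V - k - 1)
      (fun v => by exact_mod_cast hδ v) (by nlinarith) (by nlinarith) hρ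
    exact SimpleGraph.degree_sum_arith (n := Fintype.card V) (k := k) (m := m) (s := s) (t := t)
      (D := D) hk' hm1' hmk' hcard' hst' ht hk3 (by linarith) hv1 (by linarith)
end

section
/- For integers k ≥ 2 and 1 ≤ m ≤ k, let G be a connected finite simple graph of order n ≥ 13k/2 + 4m + 7 with minimum degree δ(G) ≥ k + m. If the number of edges satisfies e(G) ≥ C(n−k−1, 2) + k² + 2k + (k+1)m, then G is a fractional (k,k,m)-covered graph. -/
open Finset

/-- Hall-type criterion: under the cut condition, some set of darts of `H` has out-degree and
in-degree `f u` at every vertex `u`. -/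
theorem SimpleGraph.exists_dart_selection {V : Type*} [Fintype V] [DecidableEq V]
    (H : SimpleGraph V) [DecidableRel H.Adj] (f : V → ℕ)
    (hcut : ∀ S T : Finset V, ∑ v ∈ T, f v ≤
      ∑ v ∈ S, f v + #{p : V × V | H.Adj p.1 p.2 ∧ p.1 ∈ T ∧ p.2 ∉ S}) :
    ∃ X : Finset (V × V), (∀ p ∈ X, H.Adj p.1 p.2) ∧
      (∀ u, #{p ∈ X | p.1 = u} = f u) ∧ ∀ u, #{p ∈ X | p.2 = u} = f u := by
  classical
  let D := {p : V × V // H.Adj p.1 p.2}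
  let C := Σ v, Fin (f v)
  let R : C ⊕ D → C ⊕ D → Prop := fun a b ↦ match a, b with
    | .inl c, .inr d => d.1.1 = c.1
    | .inr d, .inr d' => d = d'
    | .inr d, .inl c => c.1 = d.1.2
    | .inl _, .inl _ => False
  have card_fibre : ∀ A : Finset V, #{c : C | c.1 ∈ A} = ∑ v ∈ A, f v := by
    intro A
    have : ({c : C | c.1 ∈ A} : Finset C) = A.sigma fun v ↦ (univ : Finset (Fin (f v))) := by
      ext c
      simp only [Finset.mem_filter, Finset.mem_univ, true_and]
      exact ⟨fun h ↦ Finset.mem_sigma.2 ⟨h, Finset.mem_univ _⟩, fun h ↦ (Finset.mem_sigma.1 h).1⟩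
    rw [this, Finset.card_sigma]
    simp
  have hall : ∀ A : Finset (C ⊕ D), #A ≤ #{b | ∃ a ∈ A, R a b} := by
    intro A
    let F : Finset D := {d | .inr d ∈ A}
    let T : Finset V := {v | ∃ i : Fin (f v), (.inl ⟨v, i⟩ : C ⊕ D) ∈ A}
    let S : Finset V := F.image fun d ↦ d.1.2
    let E : Finset D := {d | d.1.1 ∈ T ∧ d.1.2 ∉ S}
    have hE : #E = #{p : V × V | H.Adj p.1 p.2 ∧ p.1 ∈ T ∧ p.2 ∉ S} := by
      rw [← Finset.card_map (Function.Embedding.subtype _)]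
      congr 1
      ext p
      simp only [E, Finset.mem_map, Finset.mem_filter, Finset.mem_univ, true_and,
        Function.Embedding.subtype_apply]
      constructor
      · rintro ⟨d, hd, rfl⟩
        exact ⟨d.2, hd⟩
      · rintro ⟨hp, hd⟩
        exact ⟨⟨p, hp⟩, hd, rfl⟩
    have h1 : #A ≤ #(({c : C | c.1 ∈ T} : Finset C).disjSum F) := by
      apply Finset.card_le_card
      rintro (⟨v, i⟩ | d) h
      · simp only [Finset.inl_mem_disjSum, T, Finset.mem_filter, Finset.mem_univ, true_and]
        exact ⟨i, h⟩
      · simpa [F] using h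
    have hdisj : Disjoint F E := by
      rw [Finset.disjoint_left]
      intro d hF hd
      simp only [E, Finset.mem_filter] at hd
      exact hd.2.2 (Finset.mem_image_of_mem _ hF)
    have h2 : #(({c : C | c.1 ∈ S} : Finset C).disjSum (F ∪ E)) ≤ #{b | ∃ a ∈ A, R a b} := by
      apply Finset.card_le_card
      rintro (c | d) h
      · simp only [Finset.inl_mem_disjSum, S, Finset.mem_filter, Finset.mem_univ, true_and,
          Finset.mem_image, F] at h ⊢
        obtain ⟨d, hd, hc⟩ := h
        exact ⟨.inr d, hd, hc.symm⟩
      · simp only [Finset.inr_mem_disjSum, Finset.mem_union, Finset.mem_filter,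
          Finset.mem_univ, true_and, F, E, T] at h ⊢
        rcases h with h | ⟨⟨i, hi⟩, -⟩
        · exact ⟨.inr d, h, rfl⟩
        · exact ⟨.inl ⟨_, i⟩, hi, rfl⟩
    rw [Finset.card_disjSum, card_fibre] at h1 h2
    rw [Finset.card_union_of_disjoint hdisj, hE] at h2
    have := hcut S T
    omega
  obtain ⟨g, hg, hR⟩ := (Fintype.all_card_le_filter_rel_iff_exists_injective R).1 hall
  have hsurj := Finite.surjective_of_injective hg
  let Y : Finset D := {d | g (.inr d) ≠ .inr d}
  have card_map_filter : ∀ (Q : V × V → Prop) [DecidablePred Q],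
      #{p ∈ Y.map (Function.Embedding.subtype _) | Q p} = #{d ∈ Y | Q d.1} := by
    intro Q _
    rw [Finset.filter_map, Finset.card_map]
    rfl
  have card_fin : ∀ u, #{c : C | c.1 = u} = f u := by
    intro u
    simpa using card_fibre {u}
  refine ⟨Y.map (Function.Embedding.subtype _), ?_, fun u ↦ ?_, fun u ↦ ?_⟩
  · intro p hp
    obtain ⟨d, -, rfl⟩ := Finset.mem_map.1 hp
    exact d.2
  · rw [card_map_filter, ← card_fin]
    have hmaps : ∀ c : C, ∃ d : D, g (.inl c) = .inr d ∧ d.1.1 = c.1 := by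
      intro c
      have h := hR (.inl c)
      rcases hc : g (.inl c) with c' | d
      · rw [hc] at h; exact h.elim
      · rw [hc] at h; exact ⟨d, rfl, h⟩
    choose φ hφ hφ' using hmaps
    symm
    apply Finset.card_bij (fun c _ ↦ φ c)
    · intro c hc
      simp only [Finset.mem_filter, Finset.mem_univ, true_and, Y] at hc ⊢
      refine ⟨fun h ↦ ?_, (hφ' c).trans hc⟩
      cases hg (h.trans (hφ c).symm)
    · intro c _ c' _ h
      have := hφ c
      rw [h, ← hφ c'] at this
      exact Sum.inl_injective (hg this)
    · intro d hd
      simp only [Finset.mem_filter, Finset.mem_univ, true_and, Y] at hd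
      obtain ⟨a, ha⟩ := hsurj (.inr d)
      rcases a with c | d'
      · have : φ c = d := Sum.inr_injective ((hφ c).symm.trans ha)
        refine ⟨c, ?_, this⟩
        simp only [Finset.mem_filter, Finset.mem_univ, true_and]
        rw [← hφ' c, this, hd.2]
      · have h := hR (.inr d')
        rw [ha] at h
        have h' : d' = d := h
        exact absurd (h' ▸ ha) hd.1
  · rw [card_map_filter, ← card_fin]
    have hmaps : ∀ c : C, ∃ d : D, g (.inr d) = .inl c ∧ c.1 = d.1.2 := by
      intro c
      obtain ⟨a, ha⟩ := hsurj (.inl c)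
      have h := hR a
      rw [ha] at h
      rcases a with c' | d
      · exact h.elim
      · exact ⟨d, ha, h⟩
    choose φ hφ hφ' using hmaps
    symm
    apply Finset.card_bij (fun c _ ↦ φ c)
    · intro c hc
      simp only [Finset.mem_filter, Finset.mem_univ, true_and, Y] at hc ⊢
      refine ⟨fun h ↦ ?_, (hφ' c).symm.trans hc⟩
      rw [hφ c] at h
      cases h
    · intro c _ c' _ h
      have := hφ c
      rw [h, hφ c'] at this
      exact (Sum.inl_injective this).symm
    · intro d hd
      simp only [Finset.mem_filter, Finset.mem_univ, true_and, Y] at hd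
      have h := hR (.inr d)
      rcases hc : g (.inr d) with c | d'
      · rw [hc] at h
        have h' : c.1 = d.1.2 := h
        refine ⟨c, ?_, ?_⟩
        · simp only [Finset.mem_filter, Finset.mem_univ, true_and]
          rw [h', hd.2]
        · exact Sum.inr_injective (hg ((hφ c).trans hc.symm))
      · rw [hc] at h
        have h' : d = d' := h
        exact absurd (h' ▸ hc) hd.1

/-- It suffices to check the cut condition on disjoint pairs of vertex sets. -/
theorem SimpleGraph.cut_condition_of_disjoint {V : Type*} [Fintype V] [DecidableEq V]
    (H : SimpleGraph V) [DecidableRel H.Adj] (f : V → ℕ)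
    (hcut : ∀ S T : Finset V, Disjoint S T → ∑ v ∈ T, f v ≤
      ∑ v ∈ S, f v + #{p : V × V | H.Adj p.1 p.2 ∧ p.1 ∈ T ∧ p.2 ∉ S}) (S T : Finset V) :
    ∑ v ∈ T, f v ≤
      ∑ v ∈ S, f v + #{p : V × V | H.Adj p.1 p.2 ∧ p.1 ∈ T ∧ p.2 ∉ S} := by
  have hdisj : Disjoint (S \ T) (T \ S) :=
    Finset.disjoint_of_subset_right Finset.sdiff_subset Finset.sdiff_disjoint
  have h := hcut (S \ T) (T \ S) hdisj
  have hS := Finset.sum_inter_add_sum_sdiff S T f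
  have hT := Finset.sum_inter_add_sum_sdiff T S f
  rw [Finset.inter_comm] at hT
  have hcard : #{p : V × V | H.Adj p.1 p.2 ∧ p.1 ∈ T \ S ∧ p.2 ∉ S \ T} ≤
      #{p : V × V | H.Adj p.1 p.2 ∧ p.1 ∈ T ∧ p.2 ∉ S} := by
    apply Finset.card_le_card_of_injOn (fun p ↦ if p.2 ∈ S then p.swap else p)
    · intro p hp
      simp only [Finset.coe_filter, Finset.mem_univ, true_and, Set.mem_ofPred_eq,
        Finset.mem_sdiff, not_and, not_not] at hp ⊢
      split_ifs with h
      · exact ⟨hp.1.symm, hp.2.2 h, hp.2.1.2⟩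
      · exact ⟨hp.1, hp.2.1.1, h⟩
    · rintro ⟨a, b⟩ hp ⟨c, d⟩ hq hpq
      simp only [Finset.coe_filter, Finset.mem_univ, true_and, Set.mem_ofPred_eq,
        Finset.mem_sdiff, not_and, not_not] at hp hq
      simp only at hpq
      split_ifs at hpq <;> simp only [Prod.swap_prod_mk, Prod.mk.injEq] at hpq ⊢ <;> grind
  omega

/-- A vertex function satisfying the cut condition on disjoint pairs of vertex sets is the vector of
vertex sums of an edge weighting with values in `[0,1]`. -/
theorem SimpleGraph.exists_edge_weighting {V : Type*} [Fintype V] [DecidableEq V]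
    (H : SimpleGraph V) [DecidableRel H.Adj] (f : V → ℕ)
    (hcut : ∀ S T : Finset V, Disjoint S T → ∑ v ∈ T, f v ≤
      ∑ v ∈ S, f v + #{p : V × V | H.Adj p.1 p.2 ∧ p.1 ∈ T ∧ p.2 ∉ S}) :
    ∃ h : Sym2 V → ℝ, (∀ e, 0 ≤ h e ∧ h e ≤ 1) ∧
      ∀ u, ∑ v ∈ H.neighborFinset u, h s(u, v) = f u := by
  obtain ⟨X, hX, hfst, hsnd⟩ := H.exists_dart_selection f (H.cut_condition_of_disjoint f hcut)
  let x : V → V → ℝ := fun u v ↦ if (u, v) ∈ X then 1 else 0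
  have hx : ∀ u v, 0 ≤ x u v ∧ x u v ≤ 1 := by
    intro u v
    simp only [x]
    split_ifs <;> norm_num
  refine ⟨Sym2.lift ⟨fun u v ↦ (x u v + x v u) / 2, fun u v ↦ by ring⟩, fun e ↦ ?_, fun u ↦ ?_⟩
  · induction e with
    | _ u v =>
      simp only [Sym2.lift_mk]
      constructor <;> linarith [(hx u v).1, (hx u v).2, (hx v u).1, (hx v u).2]
  · simp only [Sym2.lift_mk]
    rw [← Finset.sum_div, Finset.sum_add_distrib]
    have h1 : ∑ v ∈ H.neighborFinset u, x u v = f u := by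
      simp only [x]
      rw [Finset.sum_boole, ← hfst u]
      congr 1
      apply Finset.card_bij (fun v _ ↦ (u, v))
      · intro v hv
        simp_all
      · intro v _ w _ h
        simpa using h
      · rintro ⟨a, v⟩ hp
        simp only [Finset.mem_filter] at hp
        obtain ⟨hp, rfl⟩ := hp
        exact ⟨v, by simpa [hp] using hX _ hp, rfl⟩
    have h2 : ∑ v ∈ H.neighborFinset u, x v u = f u := by
      simp only [x]
      rw [Finset.sum_boole, ← hsnd u]
      congr 1
      apply Finset.card_bij (fun v _ ↦ (v, u))
      · intro v hv
        simp_all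
      · intro v _ w _ h
        simpa using h
      · rintro ⟨v, a⟩ hp
        simp only [Finset.mem_filter] at hp
        obtain ⟨hp, rfl⟩ := hp
        exact ⟨v, by simpa [hp] using (hX _ hp).symm, rfl⟩
    rw [h1, h2]
    ring

/-- Sums over incident edges are sums over neighbours. -/
theorem SimpleGraph.sum_incidenceFinset_eq_sum_neighborFinset_s3 {V : Type*} [Fintype V]
    [DecidableEq V] (G : SimpleGraph V) [DecidableRel G.Adj] (h : Sym2 V → ℝ) (u : V) :
    ∑ e ∈ G.incidenceFinset u, h e = ∑ v ∈ G.neighborFinset u, h s(u, v) := by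
  symm
  apply Finset.sum_bij (fun v _ ↦ s(u, v))
  · intro v hv
    simpa using hv
  · intro v _ w _ hvw
    exact Sym2.congr_right.1 hvw
  · intro e he
    simp only [SimpleGraph.mem_incidenceFinset] at he
    obtain ⟨v, rfl⟩ := he.2
    exact ⟨v, by simpa using he.1, rfl⟩
  · intros
    rfl

/-- The edges of `G` either avoid `T` or are incident with a vertex of `T`. -/
theorem SimpleGraph.card_edgeFinset_le_choose_add_sum_degree {V : Type*} [Fintype V]
    [DecidableEq V] (G : SimpleGraph V) [DecidableRel G.Adj] (T : Finset V) :
    #G.edgeFinset ≤ (Fintype.card V - #T).choose 2 + ∑ v ∈ T, G.degree v := by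
  have hsub : G.edgeFinset ⊆
      (Tᶜ).offDiag.image Sym2.mk.uncurry ∪ T.biUnion fun v ↦ G.incidenceFinset v := by
    intro e he
    induction e with
    | _ u v =>
      simp only [SimpleGraph.mem_edgeFinset, SimpleGraph.mem_edgeSet] at he
      simp only [Finset.mem_union, Finset.mem_biUnion, SimpleGraph.mem_incidenceFinset]
      by_cases hu : u ∈ T
      · exact .inr ⟨u, hu, he, by simp⟩
      by_cases hv : v ∈ T
      · exact .inr ⟨v, hv, he, by simp⟩
      · refine .inl (Finset.mem_image.2 ⟨(u, v), ?_, rfl⟩)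
        simp [hu, hv, he.ne]
  refine (Finset.card_le_card hsub).trans ((Finset.card_union_le _ _).trans ?_)
  refine add_le_add ?_ (Finset.card_biUnion_le.trans ?_)
  · rw [Sym2.card_image_offDiag, Finset.card_compl]
  · simp

/-- The size bounds cannot hold together when the cut inequality fails. -/
theorem size_bounds_inconsistent {k m s L j : ℤ} (hk : 2 ≤ k) (hm1 : 1 ≤ m) (hj : 0 ≤ j)
    (hmk : m ≤ k) (hn : 11 * k + 8 * m + 12 ≤ 2 * (L + j)) (hsL : s ≤ L)
    (hks : k * s ≤ k * (k + j + 1) + 2 * m - 1)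
    (key : j * (2 * L + j - 1) + 2 * k + 2 * (k - 1) * m + 2 ≤ 2 * s * (j + 1) + 2 * k * j) :
    False := by
  have hkm : (1 : ℤ) ≤ (k - 1) * m := by nlinarith
  have hs2 : s ≤ k + j + 2 := by
    by_contra! h
    have h1 : k * (k + j + 3) ≤ k * s := mul_le_mul_of_nonneg_left (by omega) (by omega)
    linarith
  obtain rfl | hj' := hj.eq_or_lt
  · have h1 : k + 1 + (k - 1) * m ≤ s := by linarith
    have h2 : k * (k + 1 + (k - 1) * m) ≤ k * s := mul_le_mul_of_nonneg_left h1 (by omega)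
    have h3 : 2 * ((k - 1) * m) ≤ k * ((k - 1) * m) := mul_le_mul_of_nonneg_right hk (by omega)
    have h4 : 1 * m ≤ (k - 1) * m := mul_le_mul_of_nonneg_right (by omega) (by omega)
    linarith
  · have hA : 2 * L ≤ j + 4 * k + 7 := by
      have h1 : s * (j + 1) ≤ (k + j + 2) * (j + 1) :=
        mul_le_mul_of_nonneg_right hs2 (by omega)
      by_contra! h
      have h2 : j * (j + 4 * k + 8) ≤ j * (2 * L) := mul_le_mul_of_nonneg_left (by omega) hj
      linarith
    have h3 : 7 * k + 13 ≤ 3 * j := by omega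
    have h1 : s * (j + 1) ≤ L * (j + 1) := mul_le_mul_of_nonneg_right hsL (by omega)
    have h4 : j * j ≤ 2 * j + 2 * k + 3 + 2 * k * j := by linarith
    have h5 : (7 * k + 13) * j ≤ 3 * j * j := mul_le_mul_of_nonneg_right h3 hj
    have h6 : (k + 7) * (7 * k + 13) ≤ (k + 7) * (3 * j) :=
      mul_le_mul_of_nonneg_left h3 (by omega)
    nlinarith

/-- The numerical core: the cut inequality follows from the degree and size conditions. -/
theorem cut_le_of_size {k m n s t D a : ℕ} (hk : 2 ≤ k) (hm1 : 1 ≤ m) (hmk : m ≤ k)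
    (hn : 13 * k + 8 * m + 14 ≤ 2 * n) (hst : s + t ≤ n)
    (ha : a ≤ 2 * m) (has : a ≤ s * m) (hD : (k + m) * t ≤ D + s * t)
    (he : (n - k - 1).choose 2 + k ^ 2 + 2 * k + (k + 1) * m ≤
      (n - t).choose 2 + (D + s * t)) :
    k * t + a ≤ k * s + D := by
  by_contra! hlt
  have hms : m < s := by
    by_contra! hs
    have h1 : s * t ≤ m * t := Nat.mul_le_mul_right _ hs
    have h2 : a ≤ k * s := by
      rcases Nat.lt_or_ge s 2 with h | h
      · interval_cases s <;> nlinarith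
      · nlinarith
    nlinarith
  have htk : k < t := by
    by_contra! ht
    obtain ⟨r, rfl⟩ := Nat.exists_eq_add_of_lt hms
    have h1 : t * (r + 1) ≤ k * (r + 1) := Nat.mul_le_mul_right _ ht
    nlinarith
  obtain ⟨j, rfl⟩ := Nat.exists_eq_add_of_lt htk
  obtain ⟨N, rfl⟩ : ∃ N, n = N + k + 1 := ⟨n - k - 1, by omega⟩
  obtain ⟨L, rfl⟩ : ∃ L, N = L + j := ⟨N - j, by omega⟩
  have e1 : L + j + k + 1 - k - 1 = L + j := by omega
  have e2 : L + j + k + 1 - (k + j + 1) = L := by omega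
  rw [e1, e2] at he
  have choose_two : ∀ x : ℕ, 2 * ((x.choose 2 : ℕ) : ℤ) = x * (x - 1) := by
    intro x
    rcases x with _ | x
    · simp
    · have h := Nat.add_one_mul_choose_eq x 1
      rw [Nat.choose_one_right] at h
      push_cast
      have h' : ((x : ℤ) + 1) * x = ((x + 1).choose 2 : ℕ) * 2 := by exact_mod_cast h
      linarith
  have c1 := choose_two (L + j)
  have c2 := choose_two L
  zify at *
  generalize ((L + j).choose 2 : ℤ) = x at *
  generalize (L.choose 2 : ℤ) = y at *
  have key : (j : ℤ) * (2 * L + j - 1) + 2 * k + 2 * (k - 1) * m + 2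
      ≤ 2 * s * (j + 1) + 2 * k * j := by
    nlinarith
  have hks : (k : ℤ) * s ≤ k * (k + j + 1) + 2 * m - 1 := by linarith
  exact size_bounds_inconsistent (by omega) (by omega) (by positivity) (by omega)
    (by omega) (by omega) hks key

/-- size condition for a connected graph of large order and minimum degree at
least `k + m` to be fractional `(k,k,m)`-covered. -/
theorem size_ge_implies_fracKKMCovered
    {V : Type*} [Fintype V] [DecidableEq V] (G : SimpleGraph V) [DecidableRel G.Adj]
    (k m : ℕ) (hk : 2 ≤ k) (hm1 : 1 ≤ m) (hmk : m ≤ k)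
    (hconn : G.Connected)
    (hn : 13 * (k : ℝ) / 2 + 4 * (m : ℝ) + 7 ≤ (Fintype.card V : ℝ))
    (hδ : ∀ v : V, k + m ≤ G.degree v)
    (he : (Fintype.card V - k - 1).choose 2 + k ^ 2 + 2 * k + (k + 1) * m ≤
      G.edgeFinset.card) :
    G.IsFracABMCovered k k m := by
  classical
  intro M hM hMcard
  obtain ⟨B, hBadj⟩ : ∃ B : SimpleGraph V, ∀ u v, B.Adj u v ↔ s(u, v) ∈ M := by
    refine ⟨SimpleGraph.fromEdgeSet (M : Set (Sym2 V)), fun u v ↦ ?_⟩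
    simp only [SimpleGraph.fromEdgeSet_adj, Finset.mem_coe, and_iff_left_iff_imp]
    intro h
    exact (G.mem_edgeSet.1 (hM h)).ne
  have hBG : B ≤ G := fun u v h ↦ G.mem_edgeSet.1 (hM ((hBadj u v).1 h))
  have hBcard : #B.edgeFinset = m := by
    rw [← hMcard]
    congr 1
    ext e
    induction e with
    | _ u v => rw [SimpleGraph.mem_edgeFinset, SimpleGraph.mem_edgeSet, hBadj]
  have hdeg : ∀ v, B.degree v ≤ m := by
    intro v
    rw [← SimpleGraph.card_incidenceFinset_eq_degree, ← hBcard]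
    exact Finset.card_le_card (B.incidenceFinset_subset v)
  have hsum : ∑ v, B.degree v = 2 * m := by
    rw [B.sum_degrees_eq_twice_card_edges, hBcard]
  have hnbr : ∀ u, (G \ B).neighborFinset u = G.neighborFinset u \ B.neighborFinset u := by
    intro u
    ext v
    simp
  have hcut : ∀ S T : Finset V, Disjoint S T → ∑ v ∈ T, (k - B.degree v) ≤
      ∑ v ∈ S, (k - B.degree v) +
        #{p : V × V | (G \ B).Adj p.1 p.2 ∧ p.1 ∈ T ∧ p.2 ∉ S} := by
    intro S T hST
    have hfS : ∀ A : Finset V, ∑ v ∈ A, (k - B.degree v) + ∑ v ∈ A, B.degree v = k * #A := by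
      intro A
      rw [← Finset.sum_add_distrib, Finset.sum_congr rfl
        fun v _ ↦ Nat.sub_add_cancel ((hdeg v).trans hmk)]
      simp [mul_comm]
    have hcount : #{p : V × V | (G \ B).Adj p.1 p.2 ∧ p.1 ∈ T ∧ p.2 ∉ S} =
        ∑ v ∈ T, #((G \ B).neighborFinset v \ S) := by
      rw [← Finset.card_sigma]
      apply Finset.card_bij (fun p _ ↦ (⟨p.1, p.2⟩ : Σ _ : V, V))
      · intro p hp
        simp only [Finset.mem_filter, Finset.mem_univ, true_and] at hp
        simp only [Finset.mem_sigma, Finset.mem_sdiff, SimpleGraph.mem_neighborFinset]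
        exact ⟨hp.2.1, hp.1, hp.2.2⟩
      · rintro ⟨a, b⟩ _ ⟨c, d⟩ _ h
        simpa using h
      · rintro ⟨a, b⟩ h
        simp only [Finset.mem_sigma, Finset.mem_sdiff, SimpleGraph.mem_neighborFinset] at h
        exact ⟨(a, b), by simpa using ⟨h.2.1, h.1, h.2.2⟩, rfl⟩
    have hsplit : ∑ v ∈ T, #(G.neighborFinset v \ S) ≤
        ∑ v ∈ T, #((G \ B).neighborFinset v \ S) + ∑ v ∈ T, B.degree v := by
      rw [← Finset.sum_add_distrib]
      refine Finset.sum_le_sum fun v _ ↦ ?_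
      rw [← SimpleGraph.card_neighborFinset_eq_degree]
      refine (Finset.card_le_card ?_).trans (Finset.card_union_le _ _)
      rw [hnbr]
      intro w hw
      simp only [Finset.mem_union, Finset.mem_sdiff] at hw ⊢
      tauto
    have hdegT : ∑ v ∈ T, G.degree v ≤ ∑ v ∈ T, #(G.neighborFinset v \ S) + #S * #T := by
      rw [mul_comm, ← smul_eq_mul, ← Finset.sum_const, ← Finset.sum_add_distrib]
      refine Finset.sum_le_sum fun v _ ↦ ?_
      rw [← SimpleGraph.card_neighborFinset_eq_degree]
      have := Finset.le_card_sdiff S (G.neighborFinset v)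
      omega
    have hminT : (k + m) * #T ≤ ∑ v ∈ T, G.degree v := by
      rw [mul_comm, ← smul_eq_mul]
      exact Finset.card_nsmul_le_sum _ _ _ fun v _ ↦ hδ v
    have haS : ∑ v ∈ S, B.degree v ≤ #S * m := by
      rw [← smul_eq_mul]
      exact Finset.sum_le_card_nsmul _ _ _ fun v _ ↦ hdeg v
    have ha : ∑ v ∈ S, B.degree v ≤ 2 * m :=
      hsum ▸ Finset.sum_le_sum_of_subset (Finset.subset_univ S)
    have hcardST : #S + #T ≤ Fintype.card V := by
      rw [← Finset.card_union_of_disjoint hST]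
      exact Finset.card_le_univ _
    have hn' : 13 * k + 8 * m + 14 ≤ 2 * Fintype.card V := by
      have : (13 * k + 8 * m + 14 : ℝ) ≤ 2 * Fintype.card V := by linarith
      exact_mod_cast this
    have hedges := G.card_edgeFinset_le_choose_add_sum_degree T
    have hmain := cut_le_of_size hk hm1 hmk hn' hcardST ha haS (hminT.trans hdegT)
      (he.trans (hedges.trans (Nat.add_le_add_left hdegT _)))
    have hS := hfS S
    have hT := hfS T
    omega
  obtain ⟨h, h01, hsumh⟩ := (G \ B).exists_edge_weighting (fun v ↦ k - B.degree v) hcut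
  refine ⟨fun e ↦ if e ∈ M then 1 else h e, ⟨fun e _ ↦ ?_, fun u ↦ ?_⟩, fun e he ↦ by simp [he]⟩
  · dsimp only
    split_ifs
    · norm_num
    · exact h01 e
  · suffices heq : ∑ e ∈ G.incidenceFinset u, (if e ∈ M then 1 else h e) = (k : ℝ) from
      ⟨heq.ge, heq.le⟩
    rw [G.sum_incidenceFinset_eq_sum_neighborFinset_s3]
    have hsub : B.neighborFinset u ⊆ G.neighborFinset u := by
      intro v hv
      simp only [SimpleGraph.mem_neighborFinset] at hv ⊢
      exact hBG hv
    rw [← Finset.sum_sdiff hsub, ← hnbr]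
    have h1 : ∑ v ∈ (G \ B).neighborFinset u, (if s(u, v) ∈ M then 1 else h s(u, v)) =
        ((k - B.degree u : ℕ) : ℝ) := by
      rw [← hsumh u]
      refine Finset.sum_congr rfl fun v hv ↦ if_neg ?_
      rw [← hBadj]
      simp only [SimpleGraph.mem_neighborFinset, SimpleGraph.sdiff_adj] at hv
      exact hv.2
    have h2 : ∑ v ∈ B.neighborFinset u, (if s(u, v) ∈ M then 1 else h s(u, v)) =
        (B.degree u : ℝ) := by
      rw [Finset.sum_congr rfl fun v hv ↦
        if_pos ((hBadj u v).1 ((B.mem_neighborFinset u v).1 hv))]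
      simp
    rw [h1, h2, ← Nat.cast_add, Nat.sub_add_cancel ((hdeg u).trans hmk)]
end

section
/- For integers 2 ≤ a ≤ b, let G be a connected finite simple graph of order n ≥ (5b + 2a + ab + 24)/2 with minimum degree δ(G) ≥ a + 1. If the spectral radius satisfies ρ(G) ≥ n − b − 1, then G is a fractional [a,b]-covered graph. -/
open Finset

/-- `G` is fractional `[a,b]`-covered: for every edge `e` of `G` there is a fractional
`[a,b]`-factor `h` of `G` with `h e = 1`. -/
def SimpleGraph.IsFracABCovered {V : Type*} [Fintype V] [DecidableEq V]
    (G : SimpleGraph V) [DecidableRel G.Adj] (a b : ℕ) : Prop :=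
  ∀ e ∈ G.edgeSet, ∃ h : Sym2 V → ℝ, G.IsFracFactor a b h ∧ h e = 1

/-- An upper bound for the degree sum of a graph with a set pair violating the covering
condition lies strictly below the lower bound enforced by a large spectral radius. -/
theorem degree_sum_lt_of_violating_pair {a b n s t : ℝ} (ha : 2 ≤ a) (hab : a ≤ b)
    (hn : (5 * b + 2 * a + a * b + 24) / 2 ≤ n) (ht : b + 1 ≤ t)
    (hbs : b * s ≤ a * t + 1) (hst : s + t ≤ n) :
    (n - t) * (n - t - 1) + 2 * s * t + 2 * (a * t - b * s + 1) <
      (n - b - 1) * (n - b - 1 - a) + (n - 1) * (a + 1) := by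
  obtain ⟨j, hj, rfl⟩ : ∃ j, 0 ≤ j ∧ a = 2 + j := ⟨a - 2, by linarith, by ring⟩
  obtain ⟨k, hk, rfl⟩ : ∃ k, 0 ≤ k ∧ b = 2 + j + k := ⟨b - (2 + j), by linarith, by ring⟩
  obtain ⟨e, he, rfl⟩ : ∃ e, 0 ≤ e ∧
      n = (5 * (2 + j + k) + 2 * (2 + j) + (2 + j) * (2 + j + k) + 24) / 2 + e :=
    ⟨n - (5 * (2 + j + k) + 2 * (2 + j) + (2 + j) * (2 + j + k) + 24) / 2,
      by linarith, by ring⟩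
  set a := 2 + j with ha'
  set b := a + k with hb'
  set n := (5 * b + 2 * a + a * b + 24) / 2 + e with hn'
  have hc : 0 < a + b := by positivity
  have hb : 0 < b := by positivity
  obtain ⟨τ, hτ⟩ : ∃ τ, τ * (a + b) = b * n - 1 := ⟨(b * n - 1) / (a + b), by field_simp⟩
  have h1 : 0 < (b * n - 1) ^ 2 - (2 * a + 2 * b + 1) * (a + b) * (b * n - 1)
      + (b ^ 2 + 2 * b + a * b - 2) * (a + b) ^ 2 := by
    rw [hn', hb', ha']; ring_nf; positivity
  have h2 : 0 < 2 * (b * n - 1) - (2 * a + 2 * b + 1) * (a + b) := by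
    rw [hn', hb', ha']; ring_nf; positivity
  have h3 : 0 < b * n - 1 - (b + 1) * (a + b) := by
    rw [hn', hb', ha']; ring_nf; positivity
  have h4 : 0 < b * ((n - b - 1) * (n - b - 1 - a) + (n - 1) * (a + 1))
      - b * ((n - (b + 1)) * (n - (b + 1) - 1)) - 2 * (b + 1) * (a * (b + 1) + 1) := by
    rw [hn', hb', ha']; ring_nf; positivity
  clear_value n b a
  rw [← hτ] at h1 h2 h3
  have g1 : 0 < τ ^ 2 - (2 * a + 2 * b + 1) * τ + (b ^ 2 + 2 * b + a * b - 2) := by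
    have : 0 < (a + b) ^ 2 * (τ ^ 2 - (2 * a + 2 * b + 1) * τ + (b ^ 2 + 2 * b + a * b - 2)) := by
      linarith
    exact pos_of_mul_pos_right this (by positivity)
  have g2 : 0 < 2 * τ - (2 * a + 2 * b + 1) := by
    have : 0 < (a + b) * (2 * τ - (2 * a + 2 * b + 1)) := by linarith
    exact pos_of_mul_pos_right this hc.le
  have g3 : 0 < τ - (b + 1) := by
    have : 0 < (a + b) * (τ - (b + 1)) := by linarith
    exact pos_of_mul_pos_right this hc.le
  rcases le_total τ t with h | h
  · have hs : 0 ≤ 2 * (t - b) * (n - t - s) := by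
      apply mul_nonneg <;> linarith
    have : 0 ≤ (t - τ) * (t + τ - (2 * a + 2 * b + 1)) := by
      apply mul_nonneg <;> linarith
    nlinarith
  · have hs : 0 ≤ 2 * (t - b) * (a * t + 1 - b * s) := by
      apply mul_nonneg <;> linarith
    set C := (n - b - 1) * (n - b - 1 - a) + (n - 1) * (a + 1) with hC
    have hq : 0 < b * C - b * ((n - t) * (n - t - 1)) - 2 * t * (a * t + 1) := by
      have hqτ : 0 < b * C - b * ((n - τ) * (n - τ - 1)) - 2 * τ * (a * τ + 1) := by
        have : b * C - b * ((n - τ) * (n - τ - 1)) - 2 * τ * (a * τ + 1) =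
            b * (τ ^ 2 - (2 * a + 2 * b + 1) * τ + (b ^ 2 + 2 * b + a * b - 2)) := by
          rw [hC]
          linear_combination (-2 * τ + 2 * b) * hτ
        rw [this]; positivity
      have hkey : (τ - (b + 1)) * (b * C - b * ((n - t) * (n - t - 1)) - 2 * t * (a * t + 1)) =
          (τ - t) * (b * C - b * ((n - (b + 1)) * (n - (b + 1) - 1))
            - 2 * (b + 1) * (a * (b + 1) + 1))
          + (t - (b + 1)) * (b * C - b * ((n - τ) * (n - τ - 1)) - 2 * τ * (a * τ + 1))
          + (b + 2 * a) * ((τ - t) * (t - (b + 1)) * (τ - (b + 1))) := by ring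
      have e1 := mul_nonneg (sub_nonneg.2 h) h4.le
      have e2 := mul_nonneg (sub_nonneg.2 ht) hqτ.le
      have e3 : 0 ≤ (b + 2 * a) * ((τ - t) * (t - (b + 1)) * (τ - (b + 1))) := by
        have := sub_nonneg.2 h
        have := sub_nonneg.2 ht
        positivity
      rcases ht.eq_or_lt with ht' | ht'
      · rw [← ht']; exact h4
      · have e2' := mul_pos (sub_pos.2 ht') hqτ
        refine pos_of_mul_pos_right ?_ g3.le
        rw [hkey]; linarith
    refine lt_of_mul_lt_mul_left ?_ hb.le
    nlinarith

/-- A symmetric real matrix with nonnegative entries has a nonnegative eigenvector for its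
largest eigenvalue. -/
theorem Matrix.IsSymm.exists_nonneg_eigenvector {V : Type*} [Fintype V] [DecidableEq V]
    {A : Matrix V V ℝ} (hA : A.IsSymm) (hpos : ∀ i j, 0 ≤ A i j) {ρ : ℝ}
    (hρ : Module.End.HasEigenvalue (Matrix.toLin' A) ρ)
    (hmax : ∀ μ, Module.End.HasEigenvalue (Matrix.toLin' A) μ → μ ≤ ρ) :
    ∃ x : V → ℝ, (∀ i, 0 ≤ x i) ∧ x ≠ 0 ∧ A.mulVec x = ρ • x := by
  set M : Matrix V V ℝ := ρ • (1 : Matrix V V ℝ) - A with hM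
  have hMv : ∀ v, M.mulVec v = ρ • v - A.mulVec v := fun v => by
    rw [hM, Matrix.sub_mulVec, Matrix.smul_mulVec, Matrix.one_mulVec]
  have hMH : M.IsHermitian := by
    rw [Matrix.IsHermitian, Matrix.conjTranspose_eq_transpose_of_trivial, hM,
      Matrix.transpose_sub, Matrix.transpose_smul, Matrix.transpose_one, hA]
  have hPSD : M.PosSemidef := by
    rw [hMH.posSemidef_iff_eigenvalues_nonneg]
    intro i
    have h := hMH.mulVec_eigenvectorBasis i
    rw [hMv] at h
    have : Module.End.HasEigenvalue (Matrix.toLin' A) (ρ - hMH.eigenvalues i) := by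
      refine Module.End.hasEigenvalue_of_hasEigenvector
        (x := (hMH.eigenvectorBasis i).ofLp) ⟨?_, ?_⟩
      · rw [Module.End.mem_eigenspace_iff, Matrix.toLin'_apply, sub_smul, ← h]
        abel
      · intro h0
        apply hMH.eigenvectorBasis.orthonormal.ne_zero i
        ext j
        simpa using congrFun h0 j
    have := hmax _ this
    simp only [Pi.zero_apply]
    linarith
  obtain ⟨y, hy, hy0⟩ := hρ.exists_hasEigenvector
  rw [Module.End.mem_eigenspace_iff, Matrix.toLin'_apply] at hy
  refine ⟨fun i => |y i|, fun i => abs_nonneg _, ?_, ?_⟩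
  · contrapose! hy0
    ext i
    simpa using congrFun hy0 i
  set x : V → ℝ := fun i => |y i| with hx
  have hquad : ∀ v : V → ℝ, star v ⬝ᵥ M.mulVec v =
      ρ * ∑ i, v i * v i - ∑ i, ∑ j, A i j * (v i * v j) := by
    intro v
    rw [hMv, dotProduct_sub, dotProduct_smul]
    simp only [dotProduct, Matrix.mulVec, smul_eq_mul, star_trivial, Finset.mul_sum]
    congr 1
    exact Finset.sum_congr rfl fun i _ => Finset.sum_congr rfl fun j _ => by ring
  have h0 : star y ⬝ᵥ M.mulVec y = 0 := by
    rw [hMv, hy, sub_self, dotProduct_zero]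
  have h1 : star x ⬝ᵥ M.mulVec x ≤ star y ⬝ᵥ M.mulVec y := by
    rw [hquad, hquad]
    have : ∀ i, x i * x i = y i * y i := fun i => abs_mul_abs_self _
    simp only [this]
    refine sub_le_sub_left (Finset.sum_le_sum fun i _ => Finset.sum_le_sum fun j _ =>
      mul_le_mul_of_nonneg_left ?_ (hpos i j)) _
    rw [hx, ← abs_mul]
    exact le_abs_self _
  have h2 : star x ⬝ᵥ M.mulVec x = 0 :=
    le_antisymm (h1.trans h0.le) (hPSD.dotProduct_mulVec_nonneg x)
  rw [hPSD.dotProduct_mulVec_zero_iff, hMv] at h2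
  exact (sub_eq_zero.1 h2).symm

/-- The Hong–Shu–Fang bound for the spectral radius in terms of the degree sum and a lower
bound on the degrees. -/
theorem SimpleGraph.specRad_sq_le {V : Type*} [Fintype V] [DecidableEq V] (G : SimpleGraph V)
    [DecidableRel G.Adj] {δ : ℕ} (hδ : ∀ v, δ ≤ G.degree v) (hpos : 0 < G.specRad) :
    G.specRad ^ 2 - (δ - 1) * G.specRad ≤
      (∑ v, (G.degree v : ℝ)) - (Fintype.card V - 1) * δ := by
  set ρ := G.specRad with hρ
  have hdef : ρ = sSup {μ : ℝ | Module.End.HasEigenvalue (Matrix.toLin' (G.adjMatrix ℝ)) μ} := by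
    rw [hρ, SimpleGraph.specRad]
    congr!
  have hfin := Module.End.finite_hasEigenvalue (Matrix.toLin' (G.adjMatrix ℝ))
  have hne : {μ : ℝ | Module.End.HasEigenvalue (Matrix.toLin' (G.adjMatrix ℝ)) μ}.Nonempty := by
    rw [Set.nonempty_iff_ne_empty]
    intro h
    rw [h, Real.sSup_empty] at hdef
    exact hpos.ne' hdef
  have hmem := hne.csSup_mem hfin
  rw [← hdef] at hmem
  obtain ⟨x, hx, hx0, hAx⟩ := (G.isSymm_adjMatrix (α := ℝ)).exists_nonneg_eigenvector
    (fun i j => by rw [SimpleGraph.adjMatrix_apply]; split_ifs <;> norm_num) hmem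
    (fun μ hμ => hdef ▸ le_csSup hfin.bddAbove hμ)
  set A := G.adjMatrix ℝ with hA
  have hAs : ∀ u v, A u v = A v u := fun u v => (G.isSymm_adjMatrix (α := ℝ)).apply v u
  have hd : ∀ v, (G.degree v : ℝ) = ∑ w, A v w := fun v => by
    simp [hA, SimpleGraph.adjMatrix_apply, ← SimpleGraph.card_neighborFinset_eq_degree,
      SimpleGraph.neighborFinset_eq_filter]
  have hAx' : ∀ v, ∑ w, A v w * x w = ρ * x v := fun v => by
    simpa [Matrix.mulVec, dotProduct] using congrFun hAx v
  have hX : 0 < ∑ v, x v := by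
    obtain ⟨i, hi⟩ := Function.ne_iff.1 hx0
    exact Finset.sum_pos' (fun i _ => hx i) ⟨i, Finset.mem_univ i, (hx i).lt_of_ne' hi⟩
  have hS1 : ∑ v, (G.degree v : ℝ) * x v = ρ * ∑ v, x v := by
    rw [Finset.mul_sum]
    simp only [← hAx', hd, Finset.sum_mul]
    rw [Finset.sum_comm]
    exact Finset.sum_congr rfl fun v _ => Finset.sum_congr rfl fun w _ => by rw [hAs]
  have hS2 : ∑ u, (∑ v, A u v * G.degree v) * x u = ρ ^ 2 * ∑ v, x v := by
    calc ∑ u, (∑ v, A u v * G.degree v) * x u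
        = ∑ v, (G.degree v : ℝ) * ∑ u, A v u * x u := by
          simp only [Finset.sum_mul, Finset.mul_sum]
          rw [Finset.sum_comm]
          exact Finset.sum_congr rfl fun v _ => Finset.sum_congr rfl fun w _ => by
            rw [hAs]; ring
      _ = ∑ v, ρ * ((G.degree v : ℝ) * x v) :=
          Finset.sum_congr rfl fun v _ => by rw [hAx']; ring
      _ = ρ ^ 2 * ∑ v, x v := by rw [← Finset.mul_sum, hS1]; ring
  set m := ∑ v, (G.degree v : ℝ) with hm
  have hrow : ∀ u, (∑ v, A u v * G.degree v) - (δ - 1) * G.degree u ≤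
      m - (Fintype.card V - 1) * δ := by
    intro u
    have h1 : ∑ v, A u v * ((G.degree v : ℝ) - δ) ≤
        ∑ v, (((G.degree v : ℝ) - δ) - if u = v then (G.degree v : ℝ) - δ else 0) := by
      refine Finset.sum_le_sum fun v _ => ?_
      have := hδ v
      have : (δ : ℝ) ≤ G.degree v := by exact_mod_cast this
      rw [hA, SimpleGraph.adjMatrix_apply]
      split_ifs with h h'
      · exact absurd (h' ▸ h) (G.irrefl)
      · simp
      · simp
      · simpa using this
    simp only [mul_sub, Finset.sum_sub_distrib, Finset.sum_ite_eq, Finset.mem_univ, if_true,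
      ← Finset.sum_mul, ← hd, Finset.sum_const, Finset.card_univ, nsmul_eq_mul] at h1
    linarith
  have hsum : (ρ ^ 2 - (δ - 1) * ρ) * ∑ v, x v ≤ (m - (Fintype.card V - 1) * δ) * ∑ v, x v := by
    calc (ρ ^ 2 - (δ - 1) * ρ) * ∑ v, x v
        = ∑ u, ((∑ v, A u v * G.degree v) - (δ - 1) * G.degree u) * x u := by
          simp only [sub_mul _ _ (x _), Finset.sum_sub_distrib]
          rw [hS2]
          simp only [mul_assoc]
          rw [← Finset.mul_sum, hS1]; ring
      _ ≤ ∑ u, (m - (Fintype.card V - 1) * δ) * x u :=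
          Finset.sum_le_sum fun u _ => mul_le_mul_of_nonneg_right (hrow u) (hx u)
      _ = _ := by rw [Finset.mul_sum]
  exact le_of_mul_le_mul_right hsum hX

/-- A functional on real vectors that splits along layers of equal sign and is positive
somewhere is positive at a sign vector. -/
theorem exists_signType_pos_of_layers {V : Type*} [Fintype V] [DecidableEq V]
    {F : (V → ℝ) → ℝ} (hF0 : F 0 = 0)
    (hF : ∀ (y : V → ℝ) (m : ℝ), (∀ u, y u ≠ 0 → m ≤ |y u|) →
      F y = m * F (fun u => (SignType.sign (y u) : ℝ)) +
        F (fun u => y u - m * (SignType.sign (y u) : ℝ)))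
    (y : V → ℝ) (hy : 0 < F y) : ∃ z : V → SignType, 0 < F (fun u => (z u : ℝ)) := by
  induction hk : #{u | y u ≠ 0} using Nat.strong_induction_on generalizing y with
  | _ k ih =>
  have hne : ({u | y u ≠ 0} : Finset V).Nonempty := by
    by_contra h
    have : y = 0 := by
      ext u
      by_contra hu
      exact h ⟨u, by simpa using hu⟩
    rw [this, hF0] at hy
    exact hy.false
  obtain ⟨w, hw, hmin⟩ := Finset.exists_min_image _ (fun u => |y u|) hne
  simp only [Finset.mem_filter, Finset.mem_univ, true_and] at hw hmin
  by_cases hs : 0 < F (fun u => (SignType.sign (y u) : ℝ))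
  · exact ⟨_, hs⟩
  rw [hF y |y w| hmin] at hy
  refine ih _ ?_ (fun u => y u - |y w| * (SignType.sign (y u) : ℝ)) ?_ rfl
  · rw [← hk]
    refine Finset.card_lt_card ⟨fun u => ?_, fun h => ?_⟩
    · simp only [Finset.mem_filter, Finset.mem_univ, true_and]
      intro h h0
      simp [h0] at h
    · have := h (show w ∈ _ by simpa using hw)
      simp only [Finset.mem_filter, Finset.mem_univ, true_and] at this
      exact this (by rw [mul_comm, sign_mul_abs, sub_self])
  · have := mul_nonpos_of_nonneg_of_nonpos (abs_nonneg (y w)) (not_lt.1 hs)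
    linarith

theorem posPart_layer {p m : ℝ} (hp : p ≠ 0 → m ≤ |p|) :
    max p 0 = m * max (SignType.sign p : ℝ) 0 + max (p - m * (SignType.sign p : ℝ)) 0 := by
  rcases lt_trichotomy p 0 with h | h | h
  · have := hp h.ne
    rw [abs_of_neg h] at this
    simp only [sign_neg h, SignType.coe_neg_one]
    rw [max_eq_right h.le, max_eq_right (by norm_num), max_eq_right (by linarith)]
    ring
  · simp [h]
  · have := hp h.ne'
    rw [abs_of_pos h] at this
    simp only [sign_pos h, SignType.coe_one]
    rw [max_eq_left h.le, max_eq_left (by norm_num), max_eq_left (by linarith)]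
    ring

theorem posPart_add_layer {p q m : ℝ} (hp : p ≠ 0 → m ≤ |p|)
    (hq : q ≠ 0 → m ≤ |q|) :
    max (p + q) 0 = m * max ((SignType.sign p : ℝ) + (SignType.sign q : ℝ)) 0 +
      max ((p - m * (SignType.sign p : ℝ)) + (q - m * (SignType.sign q : ℝ))) 0 := by
  rcases lt_trichotomy p 0 with h | h | h
  · have h1 := hp h.ne
    rw [abs_of_neg h] at h1
    rcases lt_trichotomy q 0 with h' | h' | h'
    · have h2 := hq h'.ne
      rw [abs_of_neg h'] at h2
      simp only [sign_neg h, sign_neg h', SignType.coe_neg_one]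
      rw [max_eq_right (by linarith), max_eq_right (by norm_num), max_eq_right (by linarith)]
      ring
    · simpa [h'] using posPart_layer hp
    · simp only [sign_neg h, sign_pos h', SignType.coe_neg_one, SignType.coe_one]
      norm_num
  · simpa [h] using posPart_layer hq
  · have h1 := hp h.ne'
    rw [abs_of_pos h] at h1
    rcases lt_trichotomy q 0 with h' | h' | h'
    · simp only [sign_pos h, sign_neg h', SignType.coe_neg_one, SignType.coe_one]
      norm_num
    · simpa [h'] using posPart_layer hp
    · have h2 := hq h'.ne'
      rw [abs_of_pos h'] at h2
      simp only [sign_pos h, sign_pos h', SignType.coe_one]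
      rw [max_eq_left (by linarith), max_eq_left (by norm_num), max_eq_left (by linarith)]
      ring

namespace SimpleGraph

variable {V : Type*} [Fintype V] [DecidableEq V] (G : SimpleGraph V) [DecidableRel G.Adj]

theorem sum_incidenceFinset {M : Type*} [AddCommMonoid M] (h : Sym2 V → M) (u : V) :
    ∑ e ∈ G.incidenceFinset u, h e = ∑ v, if G.Adj u v then h s(u, v) else 0 := by
  rw [← Finset.sum_filter]
  symm
  refine Finset.sum_bij (fun v _ => s(u, v)) ?_ ?_ ?_ ?_
  · intro v hv
    simpa [mem_incidenceFinset] using hv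
  · intro v _ w _ hvw
    exact Sym2.congr_right.1 hvw
  · intro e he
    rw [mem_incidenceFinset] at he
    obtain ⟨v, rfl⟩ := Sym2.mem_iff_exists.1 he.2
    exact ⟨v, by simpa using he.1, rfl⟩
  · intros; rfl

/-- The dual functional of the system of inequalities describing fractional `[a,b]`-factors
that take the value `1` on the edge `e`. -/
noncomputable def coverDual (a b : ℝ) (e : Sym2 V) (y : V → ℝ) : ℝ :=
  (∑ u, (a * max (y u) 0 - b * (max (y u) 0 - y u))) -
    (∑ u, ∑ v, if s(u, v) = e then y u + y v
      else if G.Adj u v then max (y u + y v) 0 else 0) / 2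

theorem coverDual_layer (a b : ℝ) (e : Sym2 V) (y : V → ℝ) (m : ℝ)
    (hy : ∀ u, y u ≠ 0 → m ≤ |y u|) :
    G.coverDual a b e y = m * G.coverDual a b e (fun u => (SignType.sign (y u) : ℝ)) +
      G.coverDual a b e (fun u => y u - m * (SignType.sign (y u) : ℝ)) := by
  have h1 : ∀ u, a * max (y u) 0 - b * (max (y u) 0 - y u) =
      m * (a * max (SignType.sign (y u) : ℝ) 0 -
        b * (max (SignType.sign (y u) : ℝ) 0 - SignType.sign (y u))) +
      (a * max (y u - m * (SignType.sign (y u) : ℝ)) 0 -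
        b * (max (y u - m * (SignType.sign (y u) : ℝ)) 0 -
          (y u - m * (SignType.sign (y u) : ℝ)))) := fun u => by
    rw [posPart_layer (hy u)]; ring
  have h2 : ∀ u v, (if s(u, v) = e then y u + y v
      else if G.Adj u v then max (y u + y v) 0 else 0) =
      m * (if s(u, v) = e then (SignType.sign (y u) : ℝ) + SignType.sign (y v)
        else if G.Adj u v then max ((SignType.sign (y u) : ℝ) + SignType.sign (y v)) 0 else 0) +
      (if s(u, v) = e then
          (y u - m * (SignType.sign (y u) : ℝ)) + (y v - m * (SignType.sign (y v) : ℝ))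
        else if G.Adj u v then
          max ((y u - m * (SignType.sign (y u) : ℝ)) + (y v - m * (SignType.sign (y v) : ℝ))) 0
        else 0) := fun u v => by
    split_ifs
    · ring
    · exact posPart_add_layer (hy u) (hy v)
    · ring
  simp only [coverDual]
  rw [Finset.sum_congr rfl fun u _ => h1 u,
    Finset.sum_congr rfl fun u _ => Finset.sum_congr rfl fun v _ => h2 u v]
  simp only [Finset.sum_add_distrib, ← Finset.mul_sum]
  ring

/-- If no fractional `[a,b]`-factor takes the value `1` on the edge `e`, then some vector is a
certificate for this. -/
theorem exists_coverDual_pos {a b : ℕ} (hab : a ≤ b) {e : Sym2 V} (he : e ∈ G.edgeSet)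
    (hno : ¬ ∃ h : Sym2 V → ℝ, G.IsFracFactor a b h ∧ h e = 1) :
    ∃ y : V → ℝ, 0 < G.coverDual a b e y := by
  have hadj : ∀ {u v}, s(u, v) = e → G.Adj u v := fun h => by
    rw [← h] at he; simpa using he
  let lo : V → V → ℝ := fun u v => if s(u, v) = e then 1 else 0
  let hi : V → V → ℝ := fun u v => if G.Adj u v then 1 else 0
  let L : (V → V → ℝ) →ₗ[ℝ] (V → ℝ) :=
    { toFun := fun x u => (∑ v, (x u v + x v u)) / 2
      map_add' := fun x y => by
        ext u
        simp only [Pi.add_apply, Finset.sum_add_distrib]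
        ring
      map_smul' := fun c x => by
        ext u
        simp only [Pi.smul_apply, smul_eq_mul, RingHom.id_apply, ← mul_add, ← Finset.mul_sum]
        ring }
  have hLc : Continuous L := LinearMap.continuous_of_finiteDimensional L
  have hdisj : Disjoint (L '' Set.Icc lo hi) (Set.Icc (fun _ => (a : ℝ)) (fun _ => (b : ℝ))) := by
    rw [Set.disjoint_left]
    rintro _ ⟨x, ⟨hxlo, hxhi⟩, rfl⟩ ⟨hLa, hLb⟩
    refine hno ⟨Sym2.lift ⟨fun u v => (x u v + x v u) / 2, fun u v => by simp only [add_comm]⟩,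
      ⟨?_, ?_⟩, ?_⟩
    · intro f hf
      induction f with
      | _ u v =>
      have hf' : G.Adj u v := by simpa using hf
      have h1 := hxhi u v
      have h2 := hxhi v u
      have h3 := hxlo u v
      have h4 := hxlo v u
      have h5 : 0 ≤ lo u v := by simp only [lo]; split_ifs <;> norm_num
      have h6 : 0 ≤ lo v u := by simp only [lo]; split_ifs <;> norm_num
      simp only [hi, hf', hf'.symm, if_true] at h1 h2
      simp only [Sym2.lift_mk]
      constructor <;> linarith
    · intro u
      have : ∑ f ∈ G.incidenceFinset u, Sym2.lift
          ⟨fun u v => (x u v + x v u) / 2, fun u v => by simp only [add_comm]⟩ f = L x u := by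
        rw [sum_incidenceFinset]
        simp only [Sym2.lift_mk, L, LinearMap.coe_mk, AddHom.coe_mk, Finset.sum_div]
        refine Finset.sum_congr rfl fun v _ => ?_
        split_ifs with h
        · rfl
        · have h' : ¬ G.Adj v u := fun h' => h h'.symm
          have h1 := hxhi u v
          have h2 := hxhi v u
          have h3 := hxlo u v
          have h4 := hxlo v u
          have h5 : s(u, v) ≠ e := fun h5 => h (hadj h5)
          have h6 : s(v, u) ≠ e := fun h5 => h' (hadj h5)
          simp only [hi, lo, h, h', h5, h6, if_false] at h1 h2 h3 h4
          linarith
      rw [this]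
      exact ⟨hLa u, hLb u⟩
    · induction e with
      | _ u v =>
      have h1 := hxhi u v
      have h2 := hxhi v u
      have h3 := hxlo u v
      have h4 := hxlo v u
      have hf' : G.Adj u v := hadj rfl
      simp only [hi, lo, hf', hf'.symm, if_true, Sym2.eq_swap (a := v) (b := u)] at h1 h2 h3 h4
      simp only [Sym2.lift_mk]
      linarith
  obtain ⟨f, r, r', hf1, hrr, hf2⟩ := geometric_hahn_banach_compact_closed
    ((convex_Icc lo hi).linear_image L) (isCompact_Icc.image hLc)
    (convex_Icc (fun _ : V => (a : ℝ)) (fun _ => (b : ℝ))) isClosed_Icc hdisj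
  let y : V → ℝ := fun u => f (Pi.single u 1)
  have hfy : ∀ z : V → ℝ, f z = ∑ u, z u * y u := fun z => by
    conv_lhs => rw [pi_eq_sum_univ' z]
    simp only [map_sum, map_smul, smul_eq_mul, y]
  refine ⟨y, ?_⟩
  let x : V → V → ℝ := fun u v =>
    if s(u, v) = e then 1 else if G.Adj u v ∧ 0 < y u + y v then 1 else 0
  let z : V → ℝ := fun u => if 0 ≤ y u then a else b
  have hx : x ∈ Set.Icc lo hi := by
    constructor <;> intro u v <;> simp only [x, lo, hi]
    · split_ifs <;> norm_num
    · by_cases h : s(u, v) = e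
      · simp [h, hadj h]
      · simp only [h, if_false]
        split_ifs with h1 h2 h2
        · exact le_rfl
        · exact absurd h1.1 h2
        · exact zero_le_one
        · exact le_rfl
  have hz : z ∈ Set.Icc (fun _ : V => (a : ℝ)) (fun _ => (b : ℝ)) := by
    have : (a : ℝ) ≤ b := by exact_mod_cast hab
    constructor <;> intro u <;> simp only [z] <;> split_ifs <;> simp [this]
  have hlt : f (L x) < f z := (hf1 _ ⟨x, hx, rfl⟩).trans (hrr.trans (hf2 z hz))
  have hfz : f z = ∑ u, (a * max (y u) 0 - b * (max (y u) 0 - y u)) := by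
    rw [hfy]
    refine Finset.sum_congr rfl fun u _ => ?_
    simp only [z]
    split_ifs with h
    · rw [max_eq_left h]; ring
    · rw [max_eq_right (not_le.1 h).le]; ring
  have hfx : f (L x) = (∑ u, ∑ v, if s(u, v) = e then y u + y v
      else if G.Adj u v then max (y u + y v) 0 else 0) / 2 := by
    have hxy : ∀ u v, (if s(u, v) = e then y u + y v
        else if G.Adj u v then max (y u + y v) 0 else 0) = x u v * y u + x u v * y v := by
      intro u v
      simp only [x]
      by_cases h : s(u, v) = e
      · simp [h]
      · by_cases h1 : G.Adj u v
        · by_cases h2 : 0 < y u + y v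
          · simp [h, h1, h2, h2.le]
          · simp [h, h1, h2, not_lt.1 h2]
        · simp [h, h1]
    rw [hfy]
    simp only [hxy, L, LinearMap.coe_mk, AddHom.coe_mk, Finset.sum_add_distrib]
    rw [Finset.sum_comm (f := fun u v => x u v * y v)]
    simp only [← Finset.sum_mul, ← Finset.sum_add_distrib, ← add_mul]
    rw [Finset.sum_div]
    exact Finset.sum_congr rfl fun u _ => by ring
  rw [coverDual, ← hfz, ← hfx]
  linarith

/-- A set pair violating the covering condition exists whenever some edge cannot be assigned
the value `1` by a fractional `[a,b]`-factor. -/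
theorem exists_violating_pair {a b : ℕ} (hab : a ≤ b) {e : Sym2 V} (he : e ∈ G.edgeSet)
    (hno : ¬ ∃ h : Sym2 V → ℝ, G.IsFracFactor a b h ∧ h e = 1) :
    ∃ S T : Finset V, Disjoint S T ∧
      b * #S + ∑ u ∈ T, #{v | G.Adj u v ∧ v ∉ S} < a * #T + min 2 #S := by
  obtain ⟨y, hy⟩ := G.exists_coverDual_pos hab he hno
  obtain ⟨z, hz⟩ := exists_signType_pos_of_layers (by simp [coverDual])
    (G.coverDual_layer a b e) y hy
  let S : Finset V := {u | z u = -1}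
  let T : Finset V := {u | z u = 1}
  refine ⟨S, T, ?_, ?_⟩
  · rw [Finset.disjoint_left]
    intro u hu hu'
    simp only [S, T, Finset.mem_filter, Finset.mem_univ, true_and] at hu hu'
    rw [hu] at hu'
    exact absurd hu' (by decide)
  induction e with
  | _ p q =>
  have hpq : p ≠ q := G.ne_of_adj he
  let ψ : V → V → ℝ := fun u v => if u ∈ T then if G.Adj u v ∧ v ∉ S then 1 else 0 else 0
  let κ : ℝ := min ((z p : ℝ) + z q) 0
  let D : ℕ := ∑ u ∈ T, #{v | G.Adj u v ∧ v ∉ S}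
  have hψ : ∑ u, ∑ v, ψ u v = D := by
    simp only [D, ψ]
    push_cast
    rw [← Finset.sum_filter_add_sum_filter_not univ (· ∈ T)]
    simp only [Finset.filter_mem_eq_inter, Finset.univ_inter]
    rw [Finset.sum_congr rfl fun u hu => Finset.sum_congr rfl fun v _ => if_pos hu]
    rw [Finset.sum_eq_zero (s := {u | u ∉ T}) fun u hu => by
      simp only [Finset.mem_filter, Finset.mem_univ, true_and] at hu
      simp [hu]]
    simp only [Finset.sum_boole, add_zero]
  have hψ' : ∑ u, ∑ v, ψ v u = D := by rw [Finset.sum_comm, hψ]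
  have hκsum : ∑ u, ∑ v, (if s(u, v) = s(p, q) then κ else 0) = 2 * κ := by
    have : ∀ u v, (if s(u, v) = s(p, q) then κ else 0) =
        (if u = p then if v = q then κ else 0 else 0) +
        (if u = q then if v = p then κ else 0 else 0) := by
      intro u v
      simp only [Sym2.eq_iff]
      by_cases h1 : u = p
      · subst h1
        simp [hpq]
      · by_cases h2 : u = q <;> simp [h1, h2, hpq.symm]
    simp only [this, Finset.sum_add_distrib]
    simp
    ring
  have hκ : -(min 2 #S : ℕ) ≤ κ := by
    have h1 : #(({p, q} : Finset V) ∩ S) ≤ min 2 #S :=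
      le_min ((Finset.card_le_card Finset.inter_subset_left).trans Finset.card_le_two)
        (Finset.card_le_card Finset.inter_subset_right)
    have h2 : (#(({p, q} : Finset V) ∩ S) : ℝ) =
        (if p ∈ S then 1 else 0) + (if q ∈ S then 1 else 0) := by
      rw [← Finset.filter_mem_eq_inter, ← Finset.sum_boole, Finset.sum_pair hpq]
    have h3 : (#(({p, q} : Finset V) ∩ S) : ℝ) ≤ (min 2 #S : ℕ) := by exact_mod_cast h1
    refine (neg_le_neg h3).trans ?_
    rw [h2]
    simp only [κ, S, Finset.mem_filter, Finset.mem_univ, true_and]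
    cases z p <;> cases z q <;> simp
  have hφ : ∀ u v, ψ u v + ψ v u + (if s(u, v) = s(p, q) then κ else 0) ≤
      if s(u, v) = s(p, q) then (z u : ℝ) + z v
        else if G.Adj u v then max ((z u : ℝ) + z v) 0 else 0 := by
    intro u v
    have h1 : ψ u v + ψ v u = if G.Adj u v then max ((z u : ℝ) + z v) 0 else 0 := by
      by_cases h : G.Adj u v
      · simp only [ψ, S, T, Finset.mem_filter, Finset.mem_univ, true_and, h, h.symm]
        cases z u <;> cases z v <;> simp
      · have h' : ¬ G.Adj v u := fun h' => h h'.symm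
        simp [ψ, h, h']
    rw [h1]
    by_cases h : s(u, v) = s(p, q)
    · have hadj : G.Adj u v := by
        rw [← mem_edgeSet, h]; exact he
      have hk : κ = min ((z u : ℝ) + z v) 0 := by
        rcases Sym2.eq_iff.1 h with ⟨rfl, rfl⟩ | ⟨rfl, rfl⟩
        · rfl
        · simp only [κ, add_comm]
      simp only [h, hadj, if_true, hk]
      rw [max_add_min, add_zero]
    · simp [h]
  have hsum := Finset.sum_le_sum fun u (_ : u ∈ univ) =>
    Finset.sum_le_sum fun v (_ : v ∈ univ) => hφ u v
  simp only [Finset.sum_add_distrib] at hsum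
  rw [hψ, hψ', hκsum] at hsum
  have hlin : ∑ u, ((a : ℝ) * max (z u : ℝ) 0 - b * (max (z u : ℝ) 0 - z u)) =
      a * #T - b * #S := by
    have : ∀ u, (a : ℝ) * max (z u : ℝ) 0 - b * (max (z u : ℝ) 0 - z u) =
        a * (if z u = 1 then 1 else 0) - b * (if z u = -1 then 1 else 0) := by
      intro u
      cases z u <;> simp
    simp only [this, Finset.sum_sub_distrib, ← Finset.mul_sum, Finset.sum_boole, S, T]
  rw [coverDual, hlin] at hz
  have : (b : ℝ) * #S + D < a * #T + (min 2 #S : ℕ) := by linarith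
  exact_mod_cast this

theorem sum_degree_le (T : Finset V) :
    ∑ v, G.degree v ≤ #Tᶜ * (#Tᶜ - 1) + 2 * ∑ v ∈ T, G.degree v := by
  have h1 : ∀ u ∈ Tᶜ, G.degree u ≤ (#Tᶜ - 1) + #{v ∈ T | G.Adj v u} := by
    intro u hu
    rw [← card_neighborFinset_eq_degree, ← Finset.card_erase_of_mem hu]
    refine (Finset.card_le_card fun v hv => ?_).trans (Finset.card_union_le _ _)
    rw [mem_neighborFinset] at hv
    simp only [Finset.mem_union, Finset.mem_erase, Finset.mem_compl, Finset.mem_filter]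
    by_cases hvT : v ∈ T
    · exact Or.inr ⟨hvT, hv.symm⟩
    · exact Or.inl ⟨hv.ne', hvT⟩
  have h2 : ∑ u ∈ Tᶜ, #{v ∈ T | G.Adj v u} = ∑ v ∈ T, #{u ∈ Tᶜ | G.Adj v u} :=
    (Finset.sum_card_bipartiteAbove_eq_sum_card_bipartiteBelow G.Adj).symm
  have h3 : ∑ v ∈ T, #{u ∈ Tᶜ | G.Adj v u} ≤ ∑ v ∈ T, G.degree v := by
    refine Finset.sum_le_sum fun v _ => ?_
    rw [← card_neighborFinset_eq_degree]
    refine Finset.card_le_card fun u hu => ?_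
    simpa using (Finset.mem_filter.1 hu).2
  have h4 := Finset.sum_le_sum h1
  rw [Finset.sum_add_distrib, Finset.sum_const, smul_eq_mul, h2] at h4
  have h5 := Finset.sum_add_sum_compl T fun v => G.degree v
  omega

theorem degree_le_card_add (S : Finset V) (u : V) :
    G.degree u ≤ #{v | G.Adj u v ∧ v ∉ S} + #S := by
  rw [← card_neighborFinset_eq_degree]
  refine (Finset.card_le_card fun v hv => ?_).trans (Finset.card_union_le _ _)
  rw [mem_neighborFinset] at hv
  by_cases hvS : v ∈ S <;> simp [hv, hvS]

end SimpleGraph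

/-- spectral radius condition for a connected graph of large order and minimum
degree at least `a + 1` to be fractional `[a,b]`-covered. -/
theorem specRad_ge_implies_fracABCovered
    {V : Type*} [Fintype V] [DecidableEq V] (G : SimpleGraph V) [DecidableRel G.Adj]
    (a b : ℕ) (ha : 2 ≤ a) (hab : a ≤ b)
    (hconn : G.Connected)
    (hn : ((5 * b + 2 * a + a * b + 24 : ℕ) : ℝ) / 2 ≤ (Fintype.card V : ℝ))
    (hδ : ∀ v : V, a + 1 ≤ G.degree v)
    (hρ : (Fintype.card V : ℝ) - (b : ℝ) - 1 ≤ G.specRad) :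
    G.IsFracABCovered a b := by
  intro e he
  by_contra hno
  obtain ⟨S, T, hST, hlt⟩ := G.exists_violating_pair hab he hno
  set D := ∑ u ∈ T, #{v | G.Adj u v ∧ v ∉ S} with hD
  have hdegT : ∑ v ∈ T, G.degree v ≤ D + #T * #S := by
    refine (Finset.sum_le_sum fun u _ => G.degree_le_card_add S u).trans ?_
    rw [Finset.sum_add_distrib, Finset.sum_const, smul_eq_mul]
  have hlow : #T * (a + 1) ≤ D + #T * #S := by
    refine le_trans ?_ hdegT
    rw [← smul_eq_mul, ← Finset.sum_const]
    exact Finset.sum_le_sum fun v _ => hδ v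
  have hcard : #S + #T ≤ Fintype.card V := by
    rw [← Finset.card_union_of_disjoint hST]
    exact Finset.card_le_univ _
  have hs2 : 2 ≤ #S := by
    by_contra! h
    interval_cases hS : #S
    · simp at hlt hlow
      nlinarith
    · simp at hlt hlow
      nlinarith
  rw [min_eq_left hs2] at hlt
  have htb : b + 1 ≤ #T := by
    by_contra! h
    obtain ⟨s, hs⟩ := Nat.exists_eq_add_of_le hs2
    rw [hs] at hlt hlow
    nlinarith [Nat.mul_le_mul_left (s + 1) (Nat.lt_succ_iff.1 h)]
  have hsum := G.sum_degree_le T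
  have hcompl : (#Tᶜ : ℝ) = Fintype.card V - #T := by
    rw [Finset.card_compl, Nat.cast_sub (Finset.card_le_univ T)]
  have hmul : ((#Tᶜ * (#Tᶜ - 1) : ℕ) : ℝ) = #Tᶜ * (#Tᶜ - 1 : ℝ) := by
    rcases Nat.eq_zero_or_pos #Tᶜ with h | h
    · simp [h]
    · push_cast [Nat.cast_sub h]; rfl
  have hsumR : (∑ v, (G.degree v : ℝ)) ≤
      (Fintype.card V - #T) * (Fintype.card V - #T - 1) + 2 * (D + #T * #S) := by
    have h1 : ((∑ v, G.degree v : ℕ) : ℝ) ≤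
        ((#Tᶜ * (#Tᶜ - 1) : ℕ) : ℝ) + 2 * (D + #T * #S) := by
      exact_mod_cast (by omega : ∑ v, G.degree v ≤ #Tᶜ * (#Tᶜ - 1) + 2 * (D + #T * #S))
    rw [hmul, hcompl] at h1
    exact_mod_cast h1
  have haR : (2 : ℝ) ≤ a := by exact_mod_cast ha
  have habR : (a : ℝ) ≤ b := by exact_mod_cast hab
  have hltR : (b : ℝ) * #S + D + 1 ≤ a * #T + 2 := by exact_mod_cast hlt
  have hcardR : (#S : ℝ) + #T ≤ Fintype.card V := by exact_mod_cast hcard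
  push_cast at hn
  have hkey := degree_sum_lt_of_violating_pair (s := #S) (t := #T) haR habR hn
    (by exact_mod_cast htb) (by linarith [(Nat.cast_nonneg D : (0 : ℝ) ≤ D)]) hcardR
  have hab0 : (0 : ℝ) ≤ a * b := by positivity
  have hspec := G.specRad_sq_le hδ (by linarith)
  push_cast at hspec
  have hmono : 0 ≤ (G.specRad - (Fintype.card V - b - 1)) *
      (G.specRad + (Fintype.card V - b - 1) - a) := by
    apply mul_nonneg <;> linarith
  linarith
end
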